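/- (Estimate (3.6).) Let N ≥ 2 and N ≤ p < 2N − 1. There exists C > 0, depending only on N, p and the Littlewood–Paley function, such that for every u ∈ C_c^∞((0,∞)×ℝ^N; ℝ^N) and every q ∈ C_c^∞((0,∞)×ℝ^N), the nonlinear term V₂(u,q), with i-th component V₂(u,q)_i := −∑_{j=1}^N P_{ji} ∂_j q, satisfies ‖V₂(u,q)‖_{L¹(ℝ₊;Ḃ^{−1+N/p}_{p,1}(ℝ^N))} ≤ C ( ∑_{r=1}^{N−1} E(u)^r ) ‖∇q‖_{L¹(ℝ₊;Ḃ^{−1+N/p}_{p,1}(ℝ^N))}. -/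

import Mathlib

open MeasureTheory
open scoped BigOperators ENNReal

noncomputable section

namespace MHD

/-- A Littlewood–Paley function on a finite-dimensional real inner product space:
a nonnegative, smooth, radial, radially nonincreasing function equal to `1` on the unit
ball and supported in the ball of radius `2`. -/
structure LPF (V : Type*) [NormedAddCommGroup V] [InnerProductSpace ℝ V]
    [FiniteDimensional ℝ V] [MeasurableSpace V] [BorelSpace V] where
  chi : V → ℝ
  smooth : ContDiff ℝ (⊤ : ℕ∞) chi
  nonneg : ∀ x, 0 ≤ chi x
  radial : ∀ x y : V, ‖x‖ = ‖y‖ → chi x = chi y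
  radial_antitone : ∀ x y : V, ‖x‖ ≤ ‖y‖ → chi y ≤ chi x
  eq_one : ∀ x : V, ‖x‖ ≤ 1 → chi x = 1
  supp : ∀ x : V, 2 ≤ ‖x‖ → chi x = 0

variable {V : Type*} [NormedAddCommGroup V] [InnerProductSpace ℝ V]
    [FiniteDimensional ℝ V] [MeasurableSpace V] [BorelSpace V]

/-- `φ̂(ξ) = χ̂(ξ/2) − χ̂(ξ)`. -/
def LPF.phiHat (χ : LPF V) (ξ : V) : ℝ := χ.chi ((2 : ℝ)⁻¹ • ξ) - χ.chi ξ

/-- The `k`-th homogeneous Littlewood–Paley block `Δ̇_k f = 𝓕⁻¹(φ̂(2^{-k}·)·𝓕f)`. -/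
def LPF.block (χ : LPF V) (k : ℤ) (f : V → ℂ) : V → ℂ :=
  FourierTransformInv.fourierInv
    (fun ξ : V => ((χ.phiHat ((2 : ℝ) ^ (-k) • ξ) : ℝ) : ℂ) * FourierTransform.fourier f ξ)

/-- The `k`-th Littlewood–Paley kernel `𝓕⁻¹(φ̂(2^{-k}·))`. -/
def LPF.kernel (χ : LPF V) (k : ℤ) : V → ℂ :=
  FourierTransformInv.fourierInv (fun ξ : V => ((χ.phiHat ((2 : ℝ) ^ (-k) • ξ) : ℝ) : ℂ))

/-- The homogeneous Besov norm `‖f‖_{Ḃ^s_{p,1}} = ∑_{k∈ℤ} 2^{sk} ‖Δ̇_k f‖_{L^p} ∈ [0,∞]`. -/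
def besov (χ : LPF V) (s p : ℝ) (f : V → ℂ) : ℝ≥0∞ :=
  ∑' k : ℤ, ENNReal.ofReal ((2 : ℝ) ^ (s * (k : ℝ))) *
    eLpNorm (χ.block k f) (ENNReal.ofReal p) volume

/-- The space-time norm `∫_I ‖u(t,·)‖_{Ḃ^s_{p,1}} dt ∈ [0,∞]`. -/
def besovT (χ : LPF V) (s p : ℝ) (I : Set ℝ) (u : ℝ → V → ℂ) : ℝ≥0∞ :=
  ∫⁻ t in I, besov χ s p (u t)

/-- Euclidean space `ℝ^n`. -/
abbrev Euc (n : ℕ) := EuclideanSpace ℝ (Fin n)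

/-- Partial derivative `∂_i f` in the `i`-th coordinate direction. -/
def pdv {n : ℕ} {F : Type*} [NormedAddCommGroup F] [NormedSpace ℝ F]
    (i : Fin n) (f : Euc n → F) (y : Euc n) : F :=
  fderiv ℝ f y (EuclideanSpace.single i 1)

/-- `u ∈ C_c^∞((0,∞) × ℝ^N ; F)`. -/
def SmoothCpt (N : ℕ) {F : Type*} [NormedAddCommGroup F] [NormedSpace ℝ F]
    (u : ℝ → Euc N → F) : Prop :=
  ContDiff ℝ (⊤ : ℕ∞) (Function.uncurry u) ∧ HasCompactSupport (Function.uncurry u) ∧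
    ∀ t : ℝ, t ≤ 0 → ∀ y, u t y = 0

/-- `Q` is the family of cofactor polynomials: `Q i j` has zero constant term and
`adjugate (1 + M) i j = δ_{ij} + (Q i j)(M)` for every real `N × N` matrix `M`. -/
def IsCofactorPoly (N : ℕ) (Q : Fin N → Fin N → MvPolynomial (Fin N × Fin N) ℝ) : Prop :=
  ∀ i j : Fin N,
    MvPolynomial.constantCoeff (Q i j) = 0 ∧
    ∀ M : Matrix (Fin N) (Fin N) ℝ,
      Matrix.adjugate (1 + M) i j =
        (if i = j then (1 : ℝ) else 0) +
          MvPolynomial.eval (fun v : Fin N × Fin N => M v.1 v.2) (Q i j)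

/-- The matrix field `P_{ij}(t,y) = Q_{ij}(∫₀ᵗ Du(τ,y) dτ)`. -/
def Pmat {N : ℕ} (Q : Fin N → Fin N → MvPolynomial (Fin N × Fin N) ℝ)
    (u : ℝ → Euc N → Euc N) (t : ℝ) (y : Euc N) (i j : Fin N) : ℝ :=
  MvPolynomial.eval
    (fun v : Fin N × Fin N => ∫ τ in (0 : ℝ)..t, pdv v.2 (fun z => u τ z v.1) y) (Q i j)

/-- `E(u) = ‖D²u‖_{L¹(ℝ₊; Ḃ^s_{p,1}(ℝ^N))}`, summed over all components and all pairs of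
spatial derivatives. -/
def EE {N : ℕ} (χ : LPF (Euc N)) (s p : ℝ) (u : ℝ → Euc N → Euc N) : ℝ≥0∞ :=
  ∑ m : Fin N, ∑ i : Fin N, ∑ j : Fin N,
    besovT χ s p (Set.Ioi 0) (fun t y => ((pdv i (pdv j fun z => u t z m) y : ℝ) : ℂ))

/-- `‖∂_t u‖_{L¹(ℝ₊; Ḃ^s_{p,1}(ℝ^N))}`, summed over components. -/
def dtNorm {N : ℕ} (χ : LPF (Euc N)) (s p : ℝ) (u : ℝ → Euc N → Euc N) : ℝ≥0∞ :=
  ∑ m : Fin N,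
    besovT χ s p (Set.Ioi 0) (fun t y => ((deriv (fun τ => u τ y m) t : ℝ) : ℂ))

end MHD

open MHD

noncomputable section

namespace MHD

section LebesgueInequalities

variable {X : Type*} [MeasurableSpace X] {μ : Measure X}

/-- Jensen's inequality for a weight `w` which need not have mass one. -/
lemma lintegral_mul_rpow_le_weight {w h : X → ℝ≥0∞} (hw : AEMeasurable w μ)
    (hh : AEMeasurable h μ) {q : ℝ} (hq : 1 ≤ q) :
    (∫⁻ x, w x * h x ∂μ) ^ q ≤ (∫⁻ x, w x ∂μ) ^ (q - 1) * ∫⁻ x, w x * h x ^ q ∂μ := by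
  have hq0 : 0 < q := by linarith
  have hle : 0 ≤ 1 - 1 / q := by
    rw [sub_nonneg, div_le_one hq0]; exact hq
  have hpt : ∀ x, w x * h x = w x ^ (1 - 1 / q) * (w x * h x ^ q) ^ (1 / q) := fun x => by
    rw [ENNReal.mul_rpow_of_nonneg _ _ (by positivity), ← mul_assoc,
      ← ENNReal.rpow_add_of_nonneg _ _ hle (by positivity), ← ENNReal.rpow_mul,
      mul_one_div_cancel hq0.ne']
    simp
  simp_rw [hpt]
  calc _ ≤ ((∫⁻ x, w x ∂μ) ^ (1 - 1 / q) * (∫⁻ x, w x * h x ^ q ∂μ) ^ (1 / q)) ^ q := by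
        gcongr
        exact ENNReal.lintegral_mul_norm_pow_le hw (hw.mul (hh.pow_const q)) hle (by positivity)
          (by ring)
    _ = _ := by
        rw [ENNReal.mul_rpow_of_nonneg _ _ hq0.le, ← ENNReal.rpow_mul, ← ENNReal.rpow_mul,
          one_div_mul_cancel hq0.ne', ENNReal.rpow_one]
        congr 2
        field_simp

/-- **Minkowski's integral inequality.** -/
lemma lintegral_lintegral_rpow_le {T : Type*} [MeasurableSpace T] {ν : Measure T} [SFinite ν]
    [SigmaFinite μ] {f : T → X → ℝ≥0∞} (hf : Measurable (Function.uncurry f)) {p : ℝ}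
    (hp : 1 ≤ p) :
    (∫⁻ x, (∫⁻ t, f t x ∂ν) ^ p ∂μ) ^ (1 / p) ≤ ∫⁻ t, (∫⁻ x, f t x ^ p ∂μ) ^ (1 / p) ∂ν := by
  have hp0 : 0 < p := by linarith
  set R := ∫⁻ t, (∫⁻ x, f t x ^ p ∂μ) ^ (1 / p) ∂ν with hR
  have hle : 0 ≤ 1 - 1 / p := by
    rw [sub_nonneg, div_le_one hp0]; exact hp
  suffices h : ∫⁻ x, (∫⁻ t, f t x ∂ν) ^ p ∂μ ≤ R ^ p by
    calc _ ≤ (R ^ p) ^ (1 / p) := by gcongr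
      _ = R := by rw [← ENNReal.rpow_mul, mul_one_div_cancel hp0.ne', ENNReal.rpow_one]
  refine le_of_forall_lt fun L hL => ?_
  rw [lintegral_eq_nnreal] at hL
  obtain ⟨φ, hφ⟩ := lt_iSup_iff.1 hL
  obtain ⟨hφle, hφL⟩ := lt_iSup_iff.1 hφ
  rw [← SimpleFunc.lintegral_eq_lintegral] at hφL
  obtain ⟨g, hgφ, hgtop, hLg⟩ := exists_lt_lintegral_simpleFunc_of_lt_lintegral (f := φ) hφL
  have hg : ∀ x, (g x : ℝ≥0∞) ≤ (∫⁻ t, f t x ∂ν) ^ p := fun x =>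
    (ENNReal.coe_le_coe.2 (hgφ x)).trans (hφle x)
  refine hLg.trans_le ?_
  set I := ∫⁻ x, (g x : ℝ≥0∞) ∂μ with hI
  rcases eq_or_ne I 0 with h0 | h0
  · rw [h0]; exact zero_le
  have hgm : Measurable fun x => (g x : ℝ≥0∞) := g.measurable.coe_nnreal_ennreal
  have hfx : ∀ x, Measurable fun t => f t x := fun x => hf.comp (measurable_id.prodMk measurable_const)
  have hft : ∀ t, Measurable fun x => f t x := fun t => hf.comp (measurable_const.prodMk measurable_id)
  have key : I ≤ I ^ (1 - 1 / p) * R := by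
    calc I = ∫⁻ x, (g x : ℝ≥0∞) ^ (1 - 1 / p) * (g x : ℝ≥0∞) ^ (1 / p) ∂μ := by
          refine lintegral_congr fun x => ?_
          rw [← ENNReal.rpow_add_of_nonneg _ _ hle (by positivity)]
          simp
      _ ≤ ∫⁻ x, (g x : ℝ≥0∞) ^ (1 - 1 / p) * ∫⁻ t, f t x ∂ν ∂μ := by
          refine lintegral_mono fun x => ?_
          gcongr
          calc (g x : ℝ≥0∞) ^ (1 / p) ≤ ((∫⁻ t, f t x ∂ν) ^ p) ^ (1 / p) := by
                gcongr; exact hg x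
            _ = _ := by rw [← ENNReal.rpow_mul, mul_one_div_cancel hp0.ne', ENNReal.rpow_one]
      _ = ∫⁻ x, ∫⁻ t, (g x : ℝ≥0∞) ^ (1 - 1 / p) * f t x ∂ν ∂μ := by
          refine lintegral_congr fun x => ?_
          rw [lintegral_const_mul _ (hfx x)]
      _ = ∫⁻ t, ∫⁻ x, (g x : ℝ≥0∞) ^ (1 - 1 / p) * f t x ∂μ ∂ν := by
          refine lintegral_lintegral_swap ?_
          refine Measurable.aemeasurable ?_
          exact ((hgm.comp measurable_fst).pow_const _).mul (hf.comp measurable_swap)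
      _ ≤ ∫⁻ t, I ^ (1 - 1 / p) * (∫⁻ x, f t x ^ p ∂μ) ^ (1 / p) ∂ν := by
          refine lintegral_mono fun t => ?_
          refine le_trans (le_of_eq (lintegral_congr fun x => ?_))
            (ENNReal.lintegral_mul_norm_pow_le hgm.aemeasurable
            ((hft t).pow_const p).aemeasurable hle (by positivity) (by ring))
          rw [← ENNReal.rpow_mul, mul_one_div_cancel hp0.ne', ENNReal.rpow_one]
      _ = I ^ (1 - 1 / p) * R := by
          rw [lintegral_const_mul]
          exact (Measurable.lintegral_prod_right' (f := fun z : T × X => f z.1 z.2 ^ p)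
            (hf.pow_const p)).pow_const _
  have h1 : I ^ (1 / p) ≤ R := by
    have hne : I ^ (1 - 1 / p) ≠ 0 := by
      simp [ENNReal.rpow_eq_zero_iff, h0, hgtop.ne]
    have hnt : I ^ (1 - 1 / p) ≠ ∞ := ENNReal.rpow_ne_top_of_nonneg hle hgtop.ne
    rw [← ENNReal.mul_le_mul_iff_right hne hnt]
    refine le_trans (le_of_eq ?_) key
    rw [← ENNReal.rpow_add _ _ h0 hgtop.ne]
    simp
  calc I = (I ^ (1 / p)) ^ p := by
        rw [← ENNReal.rpow_mul, one_div_mul_cancel hp0.ne', ENNReal.rpow_one]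
    _ ≤ R ^ p := by gcongr

end LebesgueInequalities

section Young

variable {V : Type*} [AddCommGroup V] [MeasurableSpace V] [MeasurableAdd₂ V] [MeasurableNeg V]
  {μ : Measure V} [μ.IsAddLeftInvariant] [μ.IsNegInvariant]

/-- Pointwise bound for the convolution with a kernel of mass at most `A` and of size at most
`A * B`. -/
lemma lconvolution_rpow_le {k h : V → ℝ≥0∞} (hk : Measurable k) (hh : Measurable h) {A B : ℝ≥0∞}
    (hA : ∫⁻ x, k x ∂μ ≤ A) (hB : ∀ x, k x ≤ A * B) {q : ℝ} (hq : 1 ≤ q) (x : V) :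
    (∫⁻ y, k (x - y) * h y ∂μ) ^ q ≤ A ^ q * B * ∫⁻ y, h y ^ q ∂μ := by
  have hkx : Measurable fun y => k (x - y) := hk.comp (measurable_const.sub measurable_id)
  calc _ ≤ (∫⁻ y, k (x - y) ∂μ) ^ (q - 1) * ∫⁻ y, k (x - y) * h y ^ q ∂μ :=
        lintegral_mul_rpow_le_weight hkx.aemeasurable hh.aemeasurable hq
    _ ≤ A ^ (q - 1) * ∫⁻ y, A * B * h y ^ q ∂μ := by
        gcongr with y
        · rwa [lintegral_sub_left_eq_self]
        · exact hB _
    _ = A ^ (q - 1) * A * B * ∫⁻ y, h y ^ q ∂μ := by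
        rw [lintegral_const_mul _ (hh.pow_const q)]; ring
    _ = _ := by
        congr 2
        nth_rewrite 2 [← ENNReal.rpow_one A]
        rw [← ENNReal.rpow_add_of_nonneg _ _ (by linarith) zero_le_one]
        simp

/-- Young's inequality for the convolution with an integrable kernel. -/
lemma lintegral_lconvolution_rpow_le [SFinite μ] {k h : V → ℝ≥0∞} (hk : Measurable k)
    (hh : Measurable h) {A : ℝ≥0∞} (hA : ∫⁻ x, k x ∂μ ≤ A) {q : ℝ} (hq : 1 ≤ q) :
    ∫⁻ x, (∫⁻ y, k (x - y) * h y ∂μ) ^ q ∂μ ≤ A ^ q * ∫⁻ y, h y ^ q ∂μ := by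
  have hk2 : Measurable fun z : V × V => k (z.1 - z.2) := hk.comp measurable_sub
  calc _ ≤ ∫⁻ x, A ^ (q - 1) * ∫⁻ y, k (x - y) * h y ^ q ∂μ ∂μ := by
        refine lintegral_mono fun x => ?_
        have hkx : Measurable fun y => k (x - y) := hk.comp (measurable_const.sub measurable_id)
        refine (lintegral_mul_rpow_le_weight hkx.aemeasurable hh.aemeasurable hq).trans ?_
        gcongr
        rwa [lintegral_sub_left_eq_self]
    _ = A ^ (q - 1) * ∫⁻ x, ∫⁻ y, k (x - y) * h y ^ q ∂μ ∂μ := by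
        rw [lintegral_const_mul]
        exact Measurable.lintegral_prod_right' (f := fun z : V × V => k (z.1 - z.2) * h z.2 ^ q)
            (hk2.mul ((hh.comp measurable_snd).pow_const q))
    _ = A ^ (q - 1) * ∫⁻ y, ∫⁻ x, k (x - y) * h y ^ q ∂μ ∂μ := by
        rw [lintegral_lintegral_swap]
        exact (hk2.mul ((hh.comp measurable_snd).pow_const q)).aemeasurable
    _ ≤ A ^ (q - 1) * ∫⁻ y, A * h y ^ q ∂μ := by
        gcongr with y
        rw [lintegral_mul_const _
          (show Measurable fun x => k (x - y) from hk.comp (measurable_id.sub measurable_const))]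
        gcongr
        rwa [lintegral_sub_right_eq_self k y]
    _ = A ^ (q - 1) * A * ∫⁻ y, h y ^ q ∂μ := by
        rw [lintegral_const_mul _ (hh.pow_const q)]; ring
    _ = _ := by
        congr 1
        nth_rewrite 2 [← ENNReal.rpow_one A]
        rw [← ENNReal.rpow_add_of_nonneg _ _ (by linarith) zero_le_one]
        simp

/-- `L^q → L^p` bound, `q ≤ p`, for the convolution with a kernel of mass at most `A` and of size
at most `A * B`. -/
lemma lintegral_lconvolution_rpow_le' [SFinite μ] {k h : V → ℝ≥0∞} (hk : Measurable k)
    (hh : Measurable h) {A B : ℝ≥0∞} (hA : ∫⁻ x, k x ∂μ ≤ A) (hB : ∀ x, k x ≤ A * B) {q p : ℝ} (hq : 1 ≤ q)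
    (hqp : q ≤ p) :
    (∫⁻ x, (∫⁻ y, k (x - y) * h y ∂μ) ^ p ∂μ) ^ (1 / p) ≤
      A * B ^ (1 / q - 1 / p) * (∫⁻ y, h y ^ q ∂μ) ^ (1 / q) := by
  have hq0 : 0 < q := by linarith
  have hp0 : 0 < p := by linarith
  set H := ∫⁻ y, h y ^ q ∂μ
  have hr : 0 ≤ (p - q) / q := div_nonneg (by linarith) hq0.le
  have hT : Measurable fun x => ∫⁻ y, k (x - y) * h y ∂μ :=
    Measurable.lintegral_prod_right' (f := fun z : V × V => k (z.1 - z.2) * h z.2)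
      ((hk.comp measurable_sub).mul (hh.comp measurable_snd))
  have main : ∫⁻ x, (∫⁻ y, k (x - y) * h y ∂μ) ^ p ∂μ ≤
      (A ^ q * B * H) ^ ((p - q) / q) * (A ^ q * H) := by
    calc _ ≤ ∫⁻ x, (A ^ q * B * H) ^ ((p - q) / q) * (∫⁻ y, k (x - y) * h y ∂μ) ^ q ∂μ := by
          refine lintegral_mono fun x => ?_
          calc (∫⁻ y, k (x - y) * h y ∂μ) ^ p =
              ((∫⁻ y, k (x - y) * h y ∂μ) ^ q) ^ ((p - q) / q) *
                (∫⁻ y, k (x - y) * h y ∂μ) ^ q := by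
                rw [← ENNReal.rpow_mul,
                  ← ENNReal.rpow_add_of_nonneg _ _ (mul_nonneg hq0.le hr) hq0.le]
                congr 1
                field_simp
                ring
            _ ≤ _ := by
                gcongr
                exact lconvolution_rpow_le hk hh hA hB hq x
      _ = (A ^ q * B * H) ^ ((p - q) / q) * ∫⁻ x, (∫⁻ y, k (x - y) * h y ∂μ) ^ q ∂μ :=
          lintegral_const_mul _ (hT.pow_const q)
      _ ≤ _ := by
          gcongr
          exact lintegral_lconvolution_rpow_le hk hh hA hq
  have e1 : (p - q) / q * (1 / p) = 1 / q - 1 / p := by field_simp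
  have e2 : 0 ≤ 1 / q - 1 / p := by
    rw [← e1]; positivity
  calc _ ≤ ((A ^ q * B * H) ^ ((p - q) / q) * (A ^ q * H)) ^ (1 / p) := by gcongr
    _ = (A ^ q) ^ (1 / q - 1 / p) * (A ^ q) ^ (1 / p) * B ^ (1 / q - 1 / p) *
          (H ^ (1 / q - 1 / p) * H ^ (1 / p)) := by
        rw [ENNReal.mul_rpow_of_nonneg _ _ (by positivity), ← ENNReal.rpow_mul, e1,
          ENNReal.mul_rpow_of_nonneg _ _ e2, ENNReal.mul_rpow_of_nonneg _ _ e2,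
          ENNReal.mul_rpow_of_nonneg _ _ (by positivity)]
        ring
    _ = _ := by
        rw [← ENNReal.rpow_add_of_nonneg _ _ e2 (by positivity),
          ← ENNReal.rpow_add_of_nonneg _ _ e2 (by positivity), ← ENNReal.rpow_mul]
        have : q * (1 / q - 1 / p + 1 / p) = 1 := by field_simp; ring
        rw [this]
        simp

end Young

end MHD

namespace MHD

open FourierTransform SchwartzMap

set_option linter.unusedSectionVars false

section Multipliers

variable {V : Type*} [NormedAddCommGroup V] [InnerProductSpace ℝ V]
    [FiniteDimensional ℝ V] [MeasurableSpace V] [BorelSpace V]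

/-- The dilated multiplier `m(2^{-k}·)`. -/
def dyadicDilation (k : ℤ) (m : 𝓢(V, ℂ)) : 𝓢(V, ℂ) :=
  compCLMOfContinuousLinearEquiv ℂ
    (ContinuousLinearEquiv.smulLeft (R₁ := ℝ) (M₁ := V)
      (Units.mk0 ((2 : ℝ) ^ (-k)) (by positivity))) m

@[simp]
lemma dyadicDilation_apply (k : ℤ) (m : 𝓢(V, ℂ)) (ξ : V) :
    dyadicDilation k m ξ = m ((2 : ℝ) ^ (-k) • ξ) := rfl

/-- The convolution kernel of the multiplier `m(2^{-k}·)`. -/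
def dyadicKernel (k : ℤ) (m : 𝓢(V, ℂ)) : 𝓢(V, ℂ) := 𝓕⁻ (dyadicDilation k m)

/-- The Fourier multiplier with symbol `m(2^{-k}·)` on Schwartz functions. -/
def dyadicMul (k : ℤ) (m : 𝓢(V, ℂ)) : 𝓢(V, ℂ) →L[ℂ] 𝓢(V, ℂ) :=
  SchwartzMap.convolution (ContinuousLinearMap.mul ℂ ℂ) (dyadicKernel k m)

/-- The pointwise product of Schwartz functions. -/
def schwartzMul (f g : 𝓢(V, ℂ)) : 𝓢(V, ℂ) := pairing (ContinuousLinearMap.mul ℂ ℂ) f g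

@[simp]
lemma schwartzMul_apply (f g : 𝓢(V, ℂ)) (x : V) : schwartzMul f g x = f x * g x := rfl

lemma fourier_dyadicMul (k : ℤ) (m f : 𝓢(V, ℂ)) (ξ : V) :
    𝓕 (dyadicMul k m f) ξ = m ((2 : ℝ) ^ (-k) • ξ) * 𝓕 f ξ := by
  simp [dyadicMul, dyadicKernel, SchwartzMap.fourier_convolution]

lemma dyadicMul_apply (k : ℤ) (m f : 𝓢(V, ℂ)) (x : V) :
    dyadicMul k m f x = ∫ y, dyadicKernel k m (x - y) * f y := by
  rw [dyadicMul, SchwartzMap.convolution_apply, convolution_eq_swap]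
  rfl

lemma dyadicMul_eq_fourierInv (k : ℤ) (m f : 𝓢(V, ℂ)) :
    ⇑(dyadicMul k m f) = 𝓕⁻ fun ξ : V => m ((2 : ℝ) ^ (-k) • ξ) * 𝓕 (f : V → ℂ) ξ := by
  have : dyadicMul k m f = 𝓕⁻ (𝓕 (dyadicMul k m f)) := by simp
  rw [this, fourierInv_coe]
  congr 1
  ext ξ
  rw [fourier_dyadicMul, fourier_coe]

lemma ext_fourier {f g : 𝓢(V, ℂ)} (h : ∀ ξ, 𝓕 f ξ = 𝓕 g ξ) : f = g := by
  have h' : 𝓕 f = 𝓕 g := by ext ξ; exact h ξ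
  simpa using congrArg (fun F : 𝓢(V, ℂ) => (𝓕⁻ F : 𝓢(V, ℂ))) h'

lemma dyadicMul_comp_self {ψ m : 𝓢(V, ℂ)} (h : ∀ ξ, ψ ξ * m ξ = m ξ) (k : ℤ) (f : 𝓢(V, ℂ)) :
    dyadicMul k ψ (dyadicMul k m f) = dyadicMul k m f := by
  refine ext_fourier fun ξ => ?_
  rw [fourier_dyadicMul, fourier_dyadicMul, ← mul_assoc, h]

lemma dyadicKernel_apply (k : ℤ) (m : 𝓢(V, ℂ)) (x : V) :
    dyadicKernel k m x =
      ((2 : ℝ) ^ k) ^ Module.finrank ℝ V • 𝓕⁻ m ((2 : ℝ) ^ k • x) := by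
  have h := Measure.integral_comp_smul (volume : Measure V)
    (fun v : V => Real.fourierChar (inner ℝ v ((2 : ℝ) ^ k • x)) • m v) ((2 : ℝ) ^ (-k))
  rw [dyadicKernel, fourierInv_coe, fourierInv_coe, Real.fourierInv_eq, Real.fourierInv_eq]
  have e : ∀ v : V, inner ℝ ((2 : ℝ) ^ (-k) • v) ((2 : ℝ) ^ k • x) = inner ℝ v x := fun v => by
    rw [real_inner_smul_left, real_inner_smul_right, ← mul_assoc, ← zpow_add₀ two_ne_zero]
    simp
  simp only [e] at h
  simp only [dyadicDilation_apply]
  rw [h, abs_of_pos (by positivity)]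
  congr 1
  rw [zpow_neg, inv_pow, inv_inv]

/-- Size of the kernel of a dyadic multiplier. -/
def kernelBound (m : 𝓢(V, ℂ)) : ℝ≥0∞ :=
  ENNReal.ofReal (∫ x, ‖𝓕⁻ m x‖) + ENNReal.ofReal (∫ x, ‖m x‖)

lemma kernelBound_ne_top (m : 𝓢(V, ℂ)) : kernelBound m ≠ ∞ := by
  simp [kernelBound]

lemma lintegral_dyadicKernel_le (k : ℤ) (m : 𝓢(V, ℂ)) :
    ∫⁻ x, ‖dyadicKernel k m x‖ₑ ≤ kernelBound m := by
  rw [← ofReal_integral_norm_eq_lintegral_enorm (dyadicKernel k m).integrable]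
  refine le_trans (ENNReal.ofReal_le_ofReal (le_of_eq ?_)) (self_le_add_right _ _)
  simp only [dyadicKernel_apply, norm_smul]
  rw [integral_const_mul, Measure.integral_comp_smul (volume : Measure V) (fun y => ‖𝓕⁻ m y‖),
    abs_of_pos (by positivity), Real.norm_of_nonneg (by positivity), smul_eq_mul, ← mul_assoc,
    mul_inv_cancel₀ (by positivity), one_mul]

lemma two_rpow_finrank (k : ℤ) (d : ℕ) :
    ENNReal.ofReal (((2 : ℝ) ^ k) ^ d) = (2 : ℝ≥0∞) ^ ((k : ℝ) * d) := by
  rw [← Real.rpow_intCast, ← Real.rpow_natCast, ← Real.rpow_mul zero_le_two,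
    ← ENNReal.ofReal_rpow_of_pos two_pos]
  simp

lemma enorm_dyadicKernel_le (k : ℤ) (m : 𝓢(V, ℂ)) (x : V) :
    ‖dyadicKernel k m x‖ₑ ≤
      kernelBound m * (2 : ℝ≥0∞) ^ ((k : ℝ) * Module.finrank ℝ V) := by
  rw [dyadicKernel_apply, enorm_smul, Real.enorm_of_nonneg (by positivity), two_rpow_finrank,
    mul_comm]
  gcongr
  refine le_trans ?_ (self_le_add_left _ _)
  rw [fourierInv_coe, Real.fourierInv_eq, ← ofReal_norm]
  refine ENNReal.ofReal_le_ofReal ?_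
  refine (norm_integral_le_integral_norm _).trans (le_of_eq ?_)
  simp [Circle.norm_smul]

lemma enorm_dyadicMul_le (k : ℤ) (m f : 𝓢(V, ℂ)) (x : V) :
    ‖dyadicMul k m f x‖ₑ ≤ ∫⁻ y, ‖dyadicKernel k m (x - y)‖ₑ * ‖f y‖ₑ := by
  rw [dyadicMul_apply]
  refine (enorm_integral_le_lintegral_enorm _).trans (le_of_eq ?_)
  simp only [enorm_mul]

lemma measurable_enorm_schwartz (f : 𝓢(V, ℂ)) : Measurable fun x => ‖f x‖ₑ :=
  f.continuous.measurable.enorm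

lemma eLpNorm_ofReal {p : ℝ} (hp : 0 < p) (f : V → ℂ) :
    eLpNorm f (ENNReal.ofReal p) volume = (∫⁻ x, ‖f x‖ₑ ^ p) ^ (1 / p) := by
  rw [eLpNorm_eq_lintegral_rpow_enorm_toReal (by simpa using hp) (by simp),
    ENNReal.toReal_ofReal hp.le]

/-- **Bernstein's inequality**: `L^q → L^p` bound for dyadic multipliers. -/
lemma eLpNorm_dyadicMul_le (k : ℤ) (m f : 𝓢(V, ℂ)) {q p : ℝ} (hq : 1 ≤ q) (hqp : q ≤ p) :
    eLpNorm (dyadicMul k m f) (ENNReal.ofReal p) volume ≤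
      kernelBound m * (2 : ℝ≥0∞) ^ ((k : ℝ) * Module.finrank ℝ V * (1 / q - 1 / p)) *
        eLpNorm f (ENNReal.ofReal q) volume := by
  rw [eLpNorm_ofReal (by linarith), eLpNorm_ofReal (by linarith), ENNReal.rpow_mul]
  refine le_trans ?_ (lintegral_lconvolution_rpow_le' (μ := (volume : Measure V))
    (measurable_enorm_schwartz (dyadicKernel k m)) (measurable_enorm_schwartz f)
    (lintegral_dyadicKernel_le k m) (enorm_dyadicKernel_le k m) hq hqp)
  have : 0 ≤ 1 / p := by have : 0 < p := by linarith
                         positivity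
  gcongr with x
  · linarith
  · exact enorm_dyadicMul_le k m f x

/-- **Bernstein's inequality**: `L^q → L^∞` bound for dyadic multipliers. -/
lemma enorm_dyadicMul_le_eLpNorm (k : ℤ) (m f : 𝓢(V, ℂ)) {q : ℝ} (hq : 1 ≤ q) (x : V) :
    ‖dyadicMul k m f x‖ₑ ≤
      kernelBound m * (2 : ℝ≥0∞) ^ ((k : ℝ) * Module.finrank ℝ V * (1 / q)) *
        eLpNorm f (ENNReal.ofReal q) volume := by
  have hq0 : 0 < q := by linarith
  rw [eLpNorm_ofReal hq0, ENNReal.rpow_mul]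
  have h := lconvolution_rpow_le (μ := (volume : Measure V))
    (measurable_enorm_schwartz (dyadicKernel k m)) (measurable_enorm_schwartz f)
    (lintegral_dyadicKernel_le k m) (enorm_dyadicKernel_le k m) hq x
  calc ‖dyadicMul k m f x‖ₑ ≤ ((∫⁻ y, ‖dyadicKernel k m (x - y)‖ₑ * ‖f y‖ₑ) ^ q) ^ (1 / q) := by
        rw [← ENNReal.rpow_mul, mul_one_div_cancel hq0.ne', ENNReal.rpow_one]
        exact enorm_dyadicMul_le k m f x
    _ ≤ _ := ENNReal.rpow_le_rpow h (by positivity)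
    _ = _ := by
        rw [ENNReal.mul_rpow_of_nonneg _ _ (by positivity),
          ENNReal.mul_rpow_of_nonneg _ _ (by positivity), ← ENNReal.rpow_mul _ q,
          mul_one_div_cancel hq0.ne', ENNReal.rpow_one]

end Multipliers

end MHD

namespace MHD

open FourierTransform SchwartzMap Filter Topology

set_option linter.unusedSectionVars false

section LittlewoodPaley

variable {V : Type*} [NormedAddCommGroup V] [InnerProductSpace ℝ V]
    [FiniteDimensional ℝ V] [MeasurableSpace V] [BorelSpace V]

namespace LPF

lemma hasCompactSupport_chi (χ : LPF V) : HasCompactSupport fun x => (χ.chi x : ℂ) := by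
  refine HasCompactSupport.intro (isCompact_closedBall (0 : V) 2) fun x hx => ?_
  rw [Metric.mem_closedBall, dist_zero_right, not_le] at hx
  simp [χ.supp x hx.le]

/-- The low-frequency cutoff `χ̂` as a Schwartz function. -/
def chiS (χ : LPF V) : 𝓢(V, ℂ) :=
  χ.hasCompactSupport_chi.toSchwartzMap (Complex.ofRealCLM.contDiff.comp χ.smooth)

@[simp]
lemma chiS_apply (χ : LPF V) (ξ : V) : χ.chiS ξ = χ.chi ξ := rfl

/-- The Littlewood–Paley function `φ̂` as a Schwartz function. -/
def phiS (χ : LPF V) : 𝓢(V, ℂ) := dyadicDilation 1 χ.chiS - χ.chiS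

/-- A fattened Littlewood–Paley function, equal to one on the support of `φ̂`. -/
def psiS (χ : LPF V) : 𝓢(V, ℂ) := dyadicDilation 2 χ.chiS - dyadicDilation (-1) χ.chiS

lemma phiS_apply (χ : LPF V) (ξ : V) : χ.phiS ξ = χ.phiHat ξ := by
  simp [phiS, phiHat]

lemma psiS_apply (χ : LPF V) (ξ : V) :
    χ.psiS ξ = χ.chi ((4 : ℝ)⁻¹ • ξ) - χ.chi ((2 : ℝ) • ξ) := by
  simp only [psiS, sub_apply, dyadicDilation_apply, chiS_apply]
  norm_num

lemma phiS_eq_zero_of_le (χ : LPF V) {ξ : V} (h : ‖ξ‖ ≤ 1) : χ.phiS ξ = 0 := by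
  rw [phiS_apply, phiHat, χ.eq_one ξ h, χ.eq_one]
  · simp
  · rw [norm_smul]; norm_num; linarith

lemma phiS_eq_zero_of_ge (χ : LPF V) {ξ : V} (h : 4 ≤ ‖ξ‖) : χ.phiS ξ = 0 := by
  rw [phiS_apply, phiHat, χ.supp ξ (by linarith), χ.supp]
  · simp
  · rw [norm_smul]; norm_num; linarith

lemma norm_of_phiS_ne_zero (χ : LPF V) {k : ℤ} {ξ : V} (h : χ.phiS ((2 : ℝ) ^ (-k) • ξ) ≠ 0) :
    (2 : ℝ) ^ k < ‖ξ‖ ∧ ‖ξ‖ < (2 : ℝ) ^ (k + 2) := by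
  have e : ‖(2 : ℝ) ^ (-k) • ξ‖ = ‖ξ‖ / (2 : ℝ) ^ k := by
    rw [norm_smul, Real.norm_of_nonneg (by positivity), zpow_neg]
    field_simp
  have h1 : 1 < ‖(2 : ℝ) ^ (-k) • ξ‖ := by
    by_contra h'; exact h (χ.phiS_eq_zero_of_le (not_lt.1 h'))
  have h2 : ‖(2 : ℝ) ^ (-k) • ξ‖ < 4 := by
    by_contra h'; exact h (χ.phiS_eq_zero_of_ge (not_lt.1 h'))
  rw [e] at h1 h2
  rw [lt_div_iff₀ (by positivity)] at h1
  rw [div_lt_iff₀ (by positivity)] at h2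
  refine ⟨by linarith, ?_⟩
  rw [zpow_add₀ two_ne_zero]
  norm_num
  linarith

lemma psiS_eq_one (χ : LPF V) {ξ : V} (h : χ.phiS ξ ≠ 0) : χ.psiS ξ = 1 := by
  have h' := χ.norm_of_phiS_ne_zero (k := 0) (ξ := ξ) (by simpa using h)
  norm_num at h'
  rw [psiS_apply, χ.eq_one, χ.supp]
  · simp
  · rw [norm_smul]; norm_num; linarith
  · rw [norm_smul]; norm_num; linarith

lemma psiS_mul_phiS (χ : LPF V) (ξ : V) : χ.psiS ξ * χ.phiS ξ = χ.phiS ξ := by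
  by_cases h : χ.phiS ξ = 0
  · simp [h]
  · rw [χ.psiS_eq_one h, one_mul]

/-- The Littlewood–Paley block as an operator on Schwartz functions. -/
def blockS (χ : LPF V) (k : ℤ) : 𝓢(V, ℂ) →L[ℂ] 𝓢(V, ℂ) := dyadicMul k χ.phiS

lemma block_eq (χ : LPF V) (k : ℤ) (f : 𝓢(V, ℂ)) : χ.block k f = χ.blockS k f := by
  rw [blockS, dyadicMul_eq_fourierInv]
  simp only [phiS_apply]
  rfl

lemma chi_le_one (χ : LPF V) (ξ : V) : χ.chi ξ ≤ 1 := by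
  rw [← χ.eq_one (0 : V) (by simp)]
  exact χ.radial_antitone 0 ξ (by simp)

/-- The partial sum `∑_{-J ≤ j < J} Δ̇_j f`. -/
def partialSum (χ : LPF V) (J : ℕ) (f : 𝓢(V, ℂ)) : 𝓢(V, ℂ) :=
  ∑ i ∈ Finset.range (2 * J), χ.blockS ((i : ℤ) - J) f

lemma fourier_partialSum (χ : LPF V) (J : ℕ) (f : 𝓢(V, ℂ)) (ξ : V) :
    𝓕 (χ.partialSum J f) ξ =
      (χ.chi ((2 : ℝ) ^ (-(J : ℤ)) • ξ) - χ.chi ((2 : ℝ) ^ J • ξ)) * 𝓕 f ξ := by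
  have h : 𝓕 (χ.partialSum J f) = ∑ i ∈ Finset.range (2 * J), 𝓕 (χ.blockS ((i : ℤ) - J) f) :=
    map_sum (fourierCLM ℂ 𝓢(V, ℂ)) _ _
  rw [h, sum_apply]
  simp only [blockS, fourier_dyadicMul]
  rw [← Finset.sum_mul]
  congr 1
  have : ∀ i : ℕ, χ.phiS ((2 : ℝ) ^ (-((i : ℤ) - J)) • ξ) =
      (χ.chi ((2 : ℝ) ^ (-(((i + 1 : ℕ) : ℤ) - J)) • ξ) : ℂ) -
        χ.chi ((2 : ℝ) ^ (-((i : ℤ) - J)) • ξ) := fun i => by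
    simp only [phiS, sub_apply, dyadicDilation_apply, chiS_apply, smul_smul]
    rw [← zpow_add₀ two_ne_zero]
    congr 4
    push_cast
    ring_nf
  simp only [this]
  rw [Finset.sum_range_sub
    (fun i : ℕ => (χ.chi ((2 : ℝ) ^ (-((i : ℤ) - J)) • ξ) : ℂ)) (2 * J)]
  congr 4
  · push_cast; ring_nf
  · simp

lemma apply_eq_integral (f : 𝓢(V, ℂ)) (x : V) :
    f x = ∫ ξ, Real.fourierChar (inner ℝ ξ x) • 𝓕 f ξ := by
  rw [← Real.fourierInv_eq, ← fourierInv_coe]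
  simp

lemma norm_cutoff_le (χ : LPF V) (a b : V) : ‖(χ.chi a - χ.chi b : ℂ)‖ ≤ 1 := by
  rw [← Complex.ofReal_sub, Complex.norm_real, Real.norm_eq_abs, abs_le]
  constructor <;> linarith [χ.chi_le_one a, χ.chi_le_one b, χ.nonneg a, χ.nonneg b]

lemma norm_fourier_partialSum_le (χ : LPF V) (J : ℕ) (f : 𝓢(V, ℂ)) (ξ : V) :
    ‖𝓕 (χ.partialSum J f) ξ‖ ≤ ‖𝓕 f ξ‖ := by
  rw [fourier_partialSum, norm_mul]
  exact mul_le_of_le_one_left (norm_nonneg _) (χ.norm_cutoff_le _ _)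

lemma norm_partialSum_le (χ : LPF V) (J : ℕ) (f : 𝓢(V, ℂ)) (x : V) :
    ‖χ.partialSum J f x‖ ≤ ∫ ξ, ‖𝓕 f ξ‖ := by
  rw [apply_eq_integral]
  refine (norm_integral_le_integral_norm _).trans ?_
  refine integral_mono_of_nonneg (Eventually.of_forall fun _ => norm_nonneg _)
    (𝓕 f).integrable.norm (Eventually.of_forall fun ξ => ?_)
  simpa [Circle.norm_smul] using χ.norm_fourier_partialSum_le J f ξ

lemma tendsto_cutoff (χ : LPF V) {ξ : V} (hξ : ξ ≠ 0) :
    Tendsto (fun J : ℕ => (χ.chi ((2 : ℝ) ^ (-(J : ℤ)) • ξ) - χ.chi ((2 : ℝ) ^ J • ξ) : ℂ))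
      atTop (𝓝 1) := by
  have h0 : Tendsto (fun J : ℕ => (2 : ℝ) ^ (-(J : ℤ)) • ξ) atTop (𝓝 0) := by
    have : Tendsto (fun J : ℕ => ((2 : ℝ)⁻¹) ^ J) atTop (𝓝 0) :=
      tendsto_pow_atTop_nhds_zero_of_lt_one (by norm_num) (by norm_num)
    simpa [zpow_neg] using this.smul_const ξ
  have h1 : Tendsto (fun J : ℕ => (χ.chi ((2 : ℝ) ^ (-(J : ℤ)) • ξ) : ℂ)) atTop (𝓝 1) := by
    have := (Complex.continuous_ofReal.comp χ.smooth.continuous).continuousAt.tendsto.comp h0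
    simpa [Function.comp_def, χ.eq_one (0 : V) (by simp)] using this
  have h2 : Tendsto (fun J : ℕ => (χ.chi ((2 : ℝ) ^ J • ξ) : ℂ)) atTop (𝓝 0) := by
    refine tendsto_const_nhds.congr' ?_
    have : Tendsto (fun J : ℕ => (2 : ℝ) ^ J * ‖ξ‖) atTop atTop :=
      (tendsto_pow_atTop_atTop_of_one_lt one_lt_two).atTop_mul_const (norm_pos_iff.2 hξ)
    filter_upwards [this.eventually_ge_atTop 2] with J hJ
    rw [χ.supp _ (by rw [norm_smul]; simpa using hJ)]
    simp
  simpa using h1.sub h2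

lemma tendsto_partialSum [Nontrivial V] (χ : LPF V) (f : 𝓢(V, ℂ)) (x : V) :
    Tendsto (fun J => χ.partialSum J f x) atTop (𝓝 (f x)) := by
  rw [apply_eq_integral f x]
  simp_rw [fun J => apply_eq_integral (χ.partialSum J f) x]
  refine tendsto_integral_of_dominated_convergence (fun ξ => ‖𝓕 f ξ‖) (fun J => ?_)
    (𝓕 f).integrable.norm (fun J => Eventually.of_forall fun ξ => ?_) ?_
  · refine Continuous.aestronglyMeasurable ?_
    have := (𝓕 (χ.partialSum J f)).continuous
    simp only [Circle.smul_def]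
    fun_prop
  · simpa [Circle.norm_smul] using χ.norm_fourier_partialSum_le J f ξ
  · have h0 : ∀ᵐ ξ : V, ξ ≠ 0 := by simp [ae_iff]
    filter_upwards [h0] with ξ hξ
    refine Tendsto.const_smul ?_ _
    simp_rw [fourier_partialSum]
    simpa using (χ.tendsto_cutoff hξ).mul_const (𝓕 f ξ)

lemma eLpNorm_blockS_mul_le [Nontrivial V] (χ : LPF V) (m : ℤ) (f g : 𝓢(V, ℂ)) {p : ℝ}
    (hp : 1 ≤ p) :
    eLpNorm (χ.blockS m (schwartzMul f g)) (ENNReal.ofReal p) volume ≤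
      ∑' j : ℤ, ∑' k : ℤ, eLpNorm (χ.blockS m (schwartzMul (χ.blockS j f) (χ.blockS k g)))
        (ENNReal.ofReal p) volume := by
  set S : ℝ≥0∞ := ∑' j : ℤ, ∑' k : ℤ, eLpNorm
    (χ.blockS m (schwartzMul (χ.blockS j f) (χ.blockS k g))) (ENNReal.ofReal p) volume
  have hsum : ∀ (J : ℕ) (a : ℤ → ℝ≥0∞), ∑ i ∈ Finset.range (2 * J), a ((i : ℤ) - J) ≤ ∑' j, a j :=
    fun J a => by
    have hinj : Function.Injective fun i : ℕ => (i : ℤ) - J := fun i i' h => by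
      simpa using h
    calc _ ≤ ∑' i : ℕ, a ((i : ℤ) - J) := ENNReal.sum_le_tsum _
      _ ≤ _ := ENNReal.tsum_comp_le_tsum_of_injective hinj a
  refine Lp.eLpNorm_le_of_ae_tendsto (u := atTop)
    (f := fun J : ℕ => ⇑(χ.blockS m (schwartzMul (χ.partialSum J f) (χ.partialSum J g))))
    (Eventually.of_forall fun J => ?_) (fun J => (SchwartzMap.continuous _).aestronglyMeasurable)
    (Eventually.of_forall fun x => ?_)
  · have hp' : 1 ≤ ENNReal.ofReal p := by simpa using hp
    have e : ⇑(χ.blockS m (schwartzMul (χ.partialSum J f) (χ.partialSum J g))) =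
        ∑ i ∈ Finset.range (2 * J), ∑ i' ∈ Finset.range (2 * J),
          ⇑(χ.blockS m (schwartzMul (χ.blockS ((i : ℤ) - J) f) (χ.blockS ((i' : ℤ) - J) g))) := by
      simp only [partialSum, schwartzMul, map_sum, sum_apply]
      ext x
      simp [sum_apply]
      rw [Finset.sum_comm]
    rw [e]
    calc _ ≤ ∑ i ∈ Finset.range (2 * J), ∑ i' ∈ Finset.range (2 * J), eLpNorm
          (χ.blockS m (schwartzMul (χ.blockS ((i : ℤ) - J) f) (χ.blockS ((i' : ℤ) - J) g)))
          (ENNReal.ofReal p) volume := by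
          refine (eLpNorm_sum_le (fun i _ => ?_) hp').trans ?_
          · exact Finset.aestronglyMeasurable_sum _ fun i' _ =>
              (SchwartzMap.continuous _).aestronglyMeasurable
          · exact Finset.sum_le_sum fun i _ => eLpNorm_sum_le (fun i' _ =>
              (SchwartzMap.continuous _).aestronglyMeasurable) hp'
      _ ≤ S := by
          refine le_trans (Finset.sum_le_sum fun i _ => hsum J fun k => eLpNorm
            (χ.blockS m (schwartzMul (χ.blockS ((i : ℤ) - J) f) (χ.blockS k g)))
            (ENNReal.ofReal p) volume) ?_
          exact hsum J fun j => ∑' k : ℤ, eLpNorm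
            (χ.blockS m (schwartzMul (χ.blockS j f) (χ.blockS k g))) (ENNReal.ofReal p) volume
  · simp only [blockS, dyadicMul_apply]
    refine tendsto_integral_of_dominated_convergence (fun y => ‖dyadicKernel m χ.phiS (x - y)‖ *
      ((∫ ξ, ‖𝓕 f ξ‖) * ∫ ξ, ‖𝓕 g ξ‖)) (fun J => ?_) ?_
      (fun J => Eventually.of_forall fun y => ?_) (Eventually.of_forall fun y => ?_)
    · have h1 := (dyadicKernel m χ.phiS).continuous
      have h2 := (schwartzMul (χ.partialSum J f) (χ.partialSum J g)).continuous
      exact Continuous.aestronglyMeasurable (by fun_prop)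
    · exact ((dyadicKernel m χ.phiS).integrable.comp_sub_left x).norm.mul_const _
    · rw [norm_mul, schwartzMul_apply, norm_mul]
      gcongr
      · exact χ.norm_partialSum_le J f y
      · exact χ.norm_partialSum_le J g y
    · exact ((χ.tendsto_partialSum f y).mul (χ.tendsto_partialSum g y)).const_mul _

end LPF

lemma fourier_schwartzMul (F G : 𝓢(V, ℂ)) (ξ : V) :
    𝓕 (schwartzMul F G) ξ = ∫ y, 𝓕 F (ξ + y) * 𝓕 G (-y) := by
  set H := SchwartzMap.convolution (ContinuousLinearMap.mul ℂ ℂ) (𝓕⁻ F) (𝓕⁻ G) with hH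
  have h1 : schwartzMul F G = 𝓕 H := by
    rw [hH, SchwartzMap.fourier_convolution]
    simp [schwartzMul]
  have h2 : ∀ (K : 𝓢(V, ℂ)) (x : V), 𝓕⁻ K x = 𝓕 K (-x) := fun K x => by
    rw [fourierInv_coe, fourier_coe, Real.fourierInv_eq_fourier_neg]
  have h3 : 𝓕 (𝓕 H) ξ = H (-ξ) := by
    have := h2 (𝓕 H) (-ξ)
    rw [neg_neg] at this
    rw [← this]
    simp
  rw [h1, h3, hH, SchwartzMap.convolution_apply, convolution_eq_swap]
  refine integral_congr_ae (Eventually.of_forall fun y => ?_)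
  simp only [ContinuousLinearMap.mul_apply', h2]
  congr 2
  abel

lemma dyadicMul_schwartzMul_eq_zero (k : ℤ) (m F G : 𝓢(V, ℂ))
    (h : ∀ a b : V, m ((2 : ℝ) ^ (-k) • (a + b)) ≠ 0 → 𝓕 F a = 0 ∨ 𝓕 G b = 0) :
    dyadicMul k m (schwartzMul F G) = 0 := by
  refine ext_fourier fun ξ => ?_
  have h0 : 𝓕 (0 : 𝓢(V, ℂ)) ξ = 0 := by
    have : 𝓕 (0 : 𝓢(V, ℂ)) = 0 := map_zero (fourierCLM ℂ 𝓢(V, ℂ))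
    rw [this]; rfl
  rw [fourier_dyadicMul, h0, mul_eq_zero, or_iff_not_imp_left]
  intro hm
  rw [fourier_schwartzMul]
  refine integral_eq_zero_of_ae (Eventually.of_forall fun y => ?_)
  simpa using h (ξ + y) (-y) (by simpa using hm)

end LittlewoodPaley

end MHD

namespace MHD

open FourierTransform SchwartzMap

set_option linter.unusedSectionVars false

section Product

variable {V : Type*} [NormedAddCommGroup V] [InnerProductSpace ℝ V]
    [FiniteDimensional ℝ V] [MeasurableSpace V] [BorelSpace V]

lemma besov_eq (χ : LPF V) (s p : ℝ) (f : 𝓢(V, ℂ)) :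
    besov χ s p f = ∑' k : ℤ, (2 : ℝ≥0∞) ^ (s * k) *
      eLpNorm (χ.blockS k f) (ENNReal.ofReal p) volume := by
  refine tsum_congr fun k => ?_
  rw [χ.block_eq, ← ENNReal.ofReal_rpow_of_pos two_pos]
  simp

lemma two_rpow_add (x y : ℝ) : (2 : ℝ≥0∞) ^ (x + y) = 2 ^ x * 2 ^ y :=
  ENNReal.rpow_add x y two_ne_zero ENNReal.ofNat_ne_top

lemma two_rpow_mono {x y : ℝ} (h : x ≤ y) : (2 : ℝ≥0∞) ^ x ≤ 2 ^ y :=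
  ENNReal.rpow_le_rpow_of_exponent_le one_le_two h

lemma eLpNorm_schwartzMul_le {p : ℝ} (hp : 2 ≤ p) (F G : 𝓢(V, ℂ)) :
    eLpNorm (schwartzMul F G) (ENNReal.ofReal (p / 2)) volume ≤
      eLpNorm F (ENNReal.ofReal p) volume * eLpNorm G (ENNReal.ofReal p) volume := by
  have : ENNReal.HolderTriple (ENNReal.ofReal p) (ENNReal.ofReal p) (ENNReal.ofReal (p / 2)) := by
    constructor
    rw [← ENNReal.ofReal_inv_of_pos (by linarith), ← ENNReal.ofReal_inv_of_pos (by linarith),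
      ← ENNReal.ofReal_add (by positivity) (by positivity)]
    congr 1
    field_simp
    norm_num
  have e : ⇑(schwartzMul F G) = (F : V → ℂ) • (G : V → ℂ) := by ext x; rfl
  rw [e]
  exact eLpNorm_smul_le_mul_eLpNorm G.continuous.aestronglyMeasurable
    F.continuous.aestronglyMeasurable

lemma eLpNorm_schwartzMul_le_of_bound (p : ℝ) (F G : 𝓢(V, ℂ)) {M : ℝ≥0∞}
    (hM : ∀ x, ‖F x‖ₑ ≤ M) (p0 : 0 < p) :
    eLpNorm (schwartzMul F G) (ENNReal.ofReal p) volume ≤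
      M * eLpNorm G (ENNReal.ofReal p) volume := by
  rw [eLpNorm_ofReal p0, eLpNorm_ofReal p0]
  have h : ∫⁻ x, ‖schwartzMul F G x‖ₑ ^ p ≤ M ^ p * ∫⁻ x, ‖G x‖ₑ ^ p := by
    rw [← lintegral_const_mul _ ((measurable_enorm_schwartz G).pow_const p)]
    refine lintegral_mono fun x => ?_
    rw [schwartzMul_apply, enorm_mul, ← ENNReal.mul_rpow_of_nonneg _ _ p0.le]
    exact ENNReal.rpow_le_rpow (by gcongr; exact hM x) p0.le
  refine (ENNReal.rpow_le_rpow h (by positivity)).trans (le_of_eq ?_)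
  rw [ENNReal.mul_rpow_of_nonneg _ _ (by positivity), ← ENNReal.rpow_mul,
    mul_one_div_cancel p0.ne', ENNReal.rpow_one]

lemma schwartzMul_comm (F G : 𝓢(V, ℂ)) : schwartzMul F G = schwartzMul G F := by
  ext x; simp [mul_comm]

namespace LPF

lemma norm_of_fourier_blockS_ne_zero (χ : LPF V) {k : ℤ} {f : 𝓢(V, ℂ)} {ξ : V}
    (h : 𝓕 (χ.blockS k f) ξ ≠ 0) : (2 : ℝ) ^ k < ‖ξ‖ ∧ ‖ξ‖ < (2 : ℝ) ^ (k + 2) := by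
  rw [blockS, fourier_dyadicMul] at h
  exact χ.norm_of_phiS_ne_zero (left_ne_zero_of_mul h)

lemma blockS_mul_eq_zero (χ : LPF V) {m j k : ℤ} (f g : 𝓢(V, ℂ))
    (h : ∀ a b : V, (2 : ℝ) ^ j < ‖a‖ → ‖a‖ < (2 : ℝ) ^ (j + 2) → (2 : ℝ) ^ k < ‖b‖ →
      ‖b‖ < (2 : ℝ) ^ (k + 2) → (2 : ℝ) ^ m < ‖a + b‖ → ‖a + b‖ < (2 : ℝ) ^ (m + 2) → False) :
    χ.blockS m (schwartzMul (χ.blockS j f) (χ.blockS k g)) = 0 := by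
  refine dyadicMul_schwartzMul_eq_zero m _ _ _ fun a b hab => ?_
  by_contra! hc
  obtain ⟨h1, h2⟩ := χ.norm_of_fourier_blockS_ne_zero hc.1
  obtain ⟨h3, h4⟩ := χ.norm_of_fourier_blockS_ne_zero hc.2
  obtain ⟨h5, h6⟩ := χ.norm_of_phiS_ne_zero hab
  exact h a b h1 h2 h3 h4 h5 h6

lemma blockS_mul_eq_zero_of_near (χ : LPF V) {m j k : ℤ} (hjk : j ≤ k + 2) (hm : k + 5 < m)
    (f g : 𝓢(V, ℂ)) :
    χ.blockS m (schwartzMul (χ.blockS j f) (χ.blockS k g)) = 0 := by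
  refine χ.blockS_mul_eq_zero f g fun a b _ h2 _ h4 h5 _ => ?_
  have e1 : (2 : ℝ) ^ (j + 2) ≤ 2 ^ (k + 4) := zpow_le_zpow_right₀ one_le_two (by omega)
  have e2 : (2 : ℝ) ^ (k + 5) ≤ 2 ^ m := zpow_le_zpow_right₀ one_le_two (by omega)
  have e3 : (2 : ℝ) ^ (k + 2) ≤ 2 ^ (k + 4) := zpow_le_zpow_right₀ one_le_two (by omega)
  have e4 : (2 : ℝ) ^ (k + 5) = 2 ^ (k + 4) * 2 := by
    rw [← zpow_add_one₀ two_ne_zero]; congr 1; omega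
  have := norm_add_le a b
  linarith

lemma blockS_mul_eq_zero_of_far (χ : LPF V) {m j k : ℤ} (hjk : j + 3 ≤ k) (hm : 3 < |m - k|)
    (f g : 𝓢(V, ℂ)) :
    χ.blockS m (schwartzMul (χ.blockS j f) (χ.blockS k g)) = 0 := by
  rcases lt_abs.1 hm with hm | hm
  · rcases le_or_gt m (k + 5) with h | h
    · refine χ.blockS_mul_eq_zero f g fun a b _ h2 _ h4 h5 _ => ?_
      have e1 : (2 : ℝ) ^ (j + 2) ≤ 2 ^ (k + 2) := zpow_le_zpow_right₀ one_le_two (by omega)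
      have e2 : (2 : ℝ) ^ (k + 3) ≤ 2 ^ m := zpow_le_zpow_right₀ one_le_two (by omega)
      have e4 : (2 : ℝ) ^ (k + 3) = 2 ^ (k + 2) * 2 := by
        rw [← zpow_add_one₀ two_ne_zero]; congr 1; omega
      have := norm_add_le a b
      linarith
    · exact χ.blockS_mul_eq_zero_of_near (by omega) h f g
  · refine χ.blockS_mul_eq_zero f g fun a b _ h2 h3 h4 _ h6 => ?_
    have e1 : (2 : ℝ) ^ (j + 2) ≤ 2 ^ (k - 1) := zpow_le_zpow_right₀ one_le_two (by omega)
    have e2 : (2 : ℝ) ^ (m + 2) ≤ 2 ^ (k - 1) := zpow_le_zpow_right₀ one_le_two (by omega)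
    have e4 : (2 : ℝ) ^ k = 2 ^ (k - 1) * 2 := by
      rw [← zpow_add_one₀ two_ne_zero]; congr 1; omega
    have := norm_sub_le (a + b) a
    rw [add_sub_cancel_left] at this
    linarith

lemma enorm_blockS_le (χ : LPF V) (k : ℤ) (f : 𝓢(V, ℂ)) {p : ℝ} (hp : 1 ≤ p) (x : V) :
    ‖χ.blockS k f x‖ₑ ≤ kernelBound χ.psiS *
      (2 : ℝ≥0∞) ^ (Module.finrank ℝ V / p * k) *
        eLpNorm (χ.blockS k f) (ENNReal.ofReal p) volume := by
  have h := enorm_dyadicMul_le_eLpNorm k χ.psiS (χ.blockS k f) hp x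
  rw [blockS, dyadicMul_comp_self χ.psiS_mul_phiS] at h
  rwa [show (Module.finrank ℝ V / p * k : ℝ) = k * Module.finrank ℝ V * (1 / p) by ring]

lemma eLpNorm_blockS_le (χ : LPF V) (k : ℤ) (f : 𝓢(V, ℂ)) {p : ℝ} (hp : 1 ≤ p) :
    eLpNorm (χ.blockS k f) (ENNReal.ofReal p) volume ≤
      kernelBound χ.phiS * eLpNorm f (ENNReal.ofReal p) volume := by
  simpa [blockS] using eLpNorm_dyadicMul_le k χ.phiS f hp le_rfl

end LPF

/-- Off-diagonal decay of the frequency interactions in a product. -/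
def interaction (σ : ℝ) (n : ℤ) : ℝ≥0∞ :=
  (if |n| ≤ 3 then 1 else 0) + if n ≤ 5 then (2 : ℝ≥0∞) ^ (σ * n) else 0

lemma tsum_interaction_lt_top {σ : ℝ} (hσ : 0 < σ) : ∑' n, interaction σ n < ∞ := by
  have hfin : ∀ a : ℤ → ℝ≥0∞, ∀ s : Finset ℤ, (∀ n ∉ s, a n = 0) → (∀ n, a n < ∞) →
      ∑' n, a n < ∞ := fun a s h h' => by
    rw [tsum_eq_sum (s := s) (fun n hn => h n hn)]
    exact ENNReal.sum_lt_top.2 fun n _ => h' n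
  simp only [interaction]
  rw [ENNReal.tsum_add]
  refine ENNReal.add_lt_top.2 ⟨?_, ?_⟩
  · refine hfin _ (Finset.Icc (-3) 3) (fun n hn => ?_) fun n => by split_ifs <;> simp
    rw [if_neg]
    rw [abs_le]
    simpa using hn
  · have e := (Equiv.subLeft (5 : ℤ)).tsum_eq
      fun n : ℤ => if n ≤ 5 then (2 : ℝ≥0∞) ^ (σ * n) else 0
    rw [← e]
    have e2 : ∑' n : ℤ, (if (Equiv.subLeft (5 : ℤ)) n ≤ 5 then
        (2 : ℝ≥0∞) ^ (σ * ((Equiv.subLeft (5 : ℤ)) n : ℤ)) else 0) =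
        ∑' n : ℕ, (2 : ℝ≥0∞) ^ (σ * 5) * ((2 : ℝ≥0∞) ^ (-σ)) ^ n := by
      rw [← Function.Injective.tsum_eq (g := fun n : ℕ => (n : ℤ)) Nat.cast_injective]
      · refine tsum_congr fun n => ?_
        simp only [Equiv.subLeft_apply]
        rw [if_pos (by omega), ← ENNReal.rpow_natCast, ← ENNReal.rpow_mul, ← two_rpow_add]
        congr 1
        push_cast
        ring
      · intro n hn
        simp only [Equiv.subLeft_apply, Function.mem_support, ne_eq, ite_eq_right_iff,
          not_forall] at hn
        obtain ⟨h, -⟩ := hn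
        exact ⟨n.toNat, by simp; omega⟩
    rw [e2, ENNReal.tsum_mul_left, ENNReal.tsum_geometric]
    refine ENNReal.mul_lt_top (ENNReal.rpow_lt_top_of_nonneg (by positivity) (by simp)) ?_
    rw [lt_top_iff_ne_top, Ne, ENNReal.inv_eq_top, tsub_eq_zero_iff_le, not_le]
    exact ENNReal.rpow_lt_one_of_one_lt_of_neg ENNReal.one_lt_two (neg_lt_zero.2 hσ)

lemma one_le_interaction (σ : ℝ) {n : ℤ} (h : |n| ≤ 3) : 1 ≤ interaction σ n := by
  simp [interaction, h]

lemma two_rpow_le_interaction (σ : ℝ) {n : ℤ} (h : n ≤ 5) :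
    (2 : ℝ≥0∞) ^ (σ * n) ≤ interaction σ n := by
  simp [interaction, h]

lemma two_rpow_shift_le (s : ℝ) {m k : ℤ} (h : |m - k| ≤ 3) :
    (2 : ℝ≥0∞) ^ (s * m) ≤ 2 ^ (|s| * 3) * 2 ^ (s * k) := by
  rw [← two_rpow_add]
  refine two_rpow_mono ?_
  have h1 : s * ((m : ℝ) - k) ≤ |s| * 3 := by
    refine (le_abs_self _).trans ?_
    rw [abs_mul]
    gcongr
    exact_mod_cast h
  linarith

lemma product_block_low_high (χ : LPF V) {p : ℝ} (hp : 2 ≤ p) (s σ : ℝ) {j k : ℤ} (m : ℤ)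
    (f g : 𝓢(V, ℂ)) (hjk : j + 3 ≤ k) :
    (2 : ℝ≥0∞) ^ (s * m) * eLpNorm (χ.blockS m (schwartzMul (χ.blockS j f) (χ.blockS k g)))
        (ENNReal.ofReal p) volume ≤
      kernelBound χ.phiS * kernelBound χ.psiS * 2 ^ (|s| * 3) * interaction σ (m - k) *
        ((2 ^ (Module.finrank ℝ V / p * j) * eLpNorm (χ.blockS j f) (ENNReal.ofReal p) volume) *
        (2 ^ (s * k) * eLpNorm (χ.blockS k g) (ENNReal.ofReal p) volume)) := by
  rcases lt_or_ge 3 |m - k| with hm | hm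
  · rw [χ.blockS_mul_eq_zero_of_far hjk hm]
    simp
  calc _ ≤ (2 ^ (|s| * 3) * 2 ^ (s * k)) * (kernelBound χ.phiS * ((kernelBound χ.psiS *
        (2 : ℝ≥0∞) ^ (Module.finrank ℝ V / p * j) *
        eLpNorm (χ.blockS j f) (ENNReal.ofReal p) volume) *
        eLpNorm (χ.blockS k g) (ENNReal.ofReal p) volume)) := by
        refine mul_le_mul' (two_rpow_shift_le s hm)
          ((χ.eLpNorm_blockS_le m _ (by linarith)).trans ?_)
        gcongr
        exact eLpNorm_schwartzMul_le_of_bound p _ _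
          (χ.enorm_blockS_le j f (by linarith)) (by linarith)
    _ = kernelBound χ.phiS * kernelBound χ.psiS * 2 ^ (|s| * 3) * 1 *
        ((2 ^ (Module.finrank ℝ V / p * j) * eLpNorm (χ.blockS j f) (ENNReal.ofReal p) volume) *
        (2 ^ (s * k) * eLpNorm (χ.blockS k g) (ENNReal.ofReal p) volume)) := by ring
    _ ≤ _ := by gcongr; exact one_le_interaction σ hm

lemma product_block_high_low (χ : LPF V) {p : ℝ} (hp : 2 ≤ p) {s : ℝ} (σ : ℝ)
    (hs : s ≤ Module.finrank ℝ V / p) {j k : ℤ} (m : ℤ)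
    (f g : 𝓢(V, ℂ)) (hjk : k + 3 ≤ j) :
    (2 : ℝ≥0∞) ^ (s * m) * eLpNorm (χ.blockS m (schwartzMul (χ.blockS j f) (χ.blockS k g)))
        (ENNReal.ofReal p) volume ≤
      kernelBound χ.phiS * kernelBound χ.psiS * 2 ^ (|s| * 3) * interaction σ (m - j) *
        ((2 ^ (Module.finrank ℝ V / p * j) * eLpNorm (χ.blockS j f) (ENNReal.ofReal p) volume) *
        (2 ^ (s * k) * eLpNorm (χ.blockS k g) (ENNReal.ofReal p) volume)) := by
  set α : ℝ := Module.finrank ℝ V / p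
  rw [schwartzMul_comm]
  rcases lt_or_ge 3 |m - j| with hm | hm
  · rw [χ.blockS_mul_eq_zero_of_far hjk hm]
    simp
  have hexp : (2 : ℝ≥0∞) ^ (s * j) * 2 ^ (α * k) ≤ 2 ^ (α * j) * 2 ^ (s * k) := by
    rw [← two_rpow_add, ← two_rpow_add]
    refine two_rpow_mono ?_
    have h1 : (k : ℝ) + 3 ≤ j := by exact_mod_cast hjk
    nlinarith
  calc _ ≤ (2 ^ (|s| * 3) * 2 ^ (s * j)) * (kernelBound χ.phiS * ((kernelBound χ.psiS *
        (2 : ℝ≥0∞) ^ (α * k) * eLpNorm (χ.blockS k g) (ENNReal.ofReal p) volume) *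
        eLpNorm (χ.blockS j f) (ENNReal.ofReal p) volume)) := by
        refine mul_le_mul' (two_rpow_shift_le s hm)
          ((χ.eLpNorm_blockS_le m _ (by linarith)).trans ?_)
        gcongr
        exact eLpNorm_schwartzMul_le_of_bound p _ _
          (χ.enorm_blockS_le k g (by linarith)) (by linarith)
    _ = kernelBound χ.phiS * kernelBound χ.psiS * 2 ^ (|s| * 3) * 1 *
        ((2 ^ (s * j) * 2 ^ (α * k)) * eLpNorm (χ.blockS j f) (ENNReal.ofReal p) volume *
        eLpNorm (χ.blockS k g) (ENNReal.ofReal p) volume) := by ring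
    _ ≤ kernelBound χ.phiS * kernelBound χ.psiS * 2 ^ (|s| * 3) * interaction σ (m - j) *
        ((2 ^ (α * j) * 2 ^ (s * k)) * eLpNorm (χ.blockS j f) (ENNReal.ofReal p) volume *
        eLpNorm (χ.blockS k g) (ENNReal.ofReal p) volume) := by
        gcongr
        exact one_le_interaction σ hm
    _ = _ := by ring

lemma product_block_diagonal (χ : LPF V) {p : ℝ} (hp : 2 ≤ p) (s : ℝ) {j k : ℤ} (m : ℤ)
    (f g : 𝓢(V, ℂ)) (h1 : j ≤ k + 2) (h2 : k ≤ j + 2) :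
    (2 : ℝ≥0∞) ^ (s * m) * eLpNorm (χ.blockS m (schwartzMul (χ.blockS j f) (χ.blockS k g)))
        (ENNReal.ofReal p) volume ≤
      kernelBound χ.phiS * 2 ^ (Module.finrank ℝ V / p * 2) *
        interaction (s + Module.finrank ℝ V / p) (m - k) *
        ((2 ^ (Module.finrank ℝ V / p * j) * eLpNorm (χ.blockS j f) (ENNReal.ofReal p) volume) *
        (2 ^ (s * k) * eLpNorm (χ.blockS k g) (ENNReal.ofReal p) volume)) := by
  rcases lt_or_ge (k + 5) m with hm | hm
  · rw [χ.blockS_mul_eq_zero_of_near h1 hm]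
    simp
  have hB := eLpNorm_dyadicMul_le m χ.phiS (schwartzMul (χ.blockS j f) (χ.blockS k g))
    (q := p / 2) (p := p) (by linarith) (by linarith)
  have hp0 : p ≠ 0 := by linarith
  rw [show (m : ℝ) * Module.finrank ℝ V * (1 / (p / 2) - 1 / p) = Module.finrank ℝ V / p * m by
    field_simp; ring] at hB
  have hα : 0 ≤ (Module.finrank ℝ V : ℝ) / p := by positivity
  set α : ℝ := Module.finrank ℝ V / p
  have hexp : (2 : ℝ≥0∞) ^ (s * m) * 2 ^ (α * m) ≤
      2 ^ (α * 2) * 2 ^ ((s + α) * (m - k : ℤ)) * (2 ^ (α * j) * 2 ^ (s * k)) := by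
    simp only [← two_rpow_add]
    refine two_rpow_mono ?_
    have h1 : (k : ℝ) ≤ j + 2 := by exact_mod_cast h2
    push_cast
    nlinarith
  calc _ ≤ 2 ^ (s * m) * (kernelBound χ.phiS * 2 ^ (α * m) *
        (eLpNorm (χ.blockS j f) (ENNReal.ofReal p) volume *
        eLpNorm (χ.blockS k g) (ENNReal.ofReal p) volume)) := by
        gcongr
        refine hB.trans ?_
        gcongr
        exact eLpNorm_schwartzMul_le hp _ _
    _ = kernelBound χ.phiS * (2 ^ (s * m) * 2 ^ (α * m)) *
        (eLpNorm (χ.blockS j f) (ENNReal.ofReal p) volume *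
        eLpNorm (χ.blockS k g) (ENNReal.ofReal p) volume) := by ring
    _ ≤ kernelBound χ.phiS * (2 ^ (α * 2) * interaction (s + α) (m - k) *
        (2 ^ (α * j) * 2 ^ (s * k))) *
        (eLpNorm (χ.blockS j f) (ENNReal.ofReal p) volume *
        eLpNorm (χ.blockS k g) (ENNReal.ofReal p) volume) := by
        refine mul_le_mul_left (mul_le_mul_right (hexp.trans ?_) _) _
        gcongr
        exact two_rpow_le_interaction _ (by omega)
    _ = _ := by ring

/-- The constant in a single frequency interaction. -/
def productBlockConst (χ : LPF V) (p s : ℝ) : ℝ≥0∞ :=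
  kernelBound χ.phiS * kernelBound χ.psiS * 2 ^ (|s| * 3) +
    kernelBound χ.phiS * 2 ^ (Module.finrank ℝ V / p * 2)

lemma productBlockConst_ne_top (χ : LPF V) {p : ℝ} (hp : 2 ≤ p) (s : ℝ) :
    productBlockConst χ p s ≠ ∞ := by
  refine ENNReal.add_ne_top.2 ⟨?_, ?_⟩
  · refine ENNReal.mul_ne_top (ENNReal.mul_ne_top (kernelBound_ne_top _) (kernelBound_ne_top _)) ?_
    exact ENNReal.rpow_ne_top_of_nonneg (by positivity) (by simp)
  · refine ENNReal.mul_ne_top (kernelBound_ne_top _) ?_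
    exact ENNReal.rpow_ne_top_of_nonneg (by positivity) (by simp)

lemma product_block (χ : LPF V) {p : ℝ} (hp : 2 ≤ p) {s : ℝ}
    (hs : s ≤ Module.finrank ℝ V / p) (j k m : ℤ) (f g : 𝓢(V, ℂ)) :
    (2 : ℝ≥0∞) ^ (s * m) * eLpNorm (χ.blockS m (schwartzMul (χ.blockS j f) (χ.blockS k g)))
        (ENNReal.ofReal p) volume ≤
      (interaction (s + Module.finrank ℝ V / p) (m - j) +
        interaction (s + Module.finrank ℝ V / p) (m - k)) * (productBlockConst χ p s *
        ((2 ^ (Module.finrank ℝ V / p * j) * eLpNorm (χ.blockS j f) (ENNReal.ofReal p) volume) *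
        (2 ^ (s * k) * eLpNorm (χ.blockS k g) (ENNReal.ofReal p) volume))) := by
  rw [← mul_assoc, mul_comm (_ + _) (productBlockConst χ p s)]
  rcases le_or_gt (j + 3) k with h | h
  · refine (product_block_low_high χ hp s (s + Module.finrank ℝ V / p) m f g h).trans ?_
    exact mul_le_mul_left (mul_le_mul' (self_le_add_right _ _) (self_le_add_left _ _)) _
  · rcases le_or_gt (k + 3) j with h' | h'
    · refine (product_block_high_low χ hp (s + Module.finrank ℝ V / p) hs m f g h').trans ?_
      exact mul_le_mul_left (mul_le_mul' (self_le_add_right _ _) (self_le_add_right _ _)) _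
    · refine (product_block_diagonal χ hp s m f g (by omega) (by omega)).trans ?_
      exact mul_le_mul_left (mul_le_mul' (self_le_add_left _ _) (self_le_add_left _ _)) _

/-- **Product law** `Ḃ^{d/p}_{p,1} · Ḃ^s_{p,1} ⊂ Ḃ^s_{p,1}` for `-d/p < s ≤ d/p`. -/
lemma exists_besov_schwartzMul_le [Nontrivial V] (χ : LPF V) {p : ℝ} (hp : 2 ≤ p) {s : ℝ}
    (hs : s ≤ Module.finrank ℝ V / p) (hs' : 0 < s + Module.finrank ℝ V / p) :
    ∃ C : ℝ≥0∞, C ≠ ∞ ∧ ∀ f g : 𝓢(V, ℂ), besov χ s p (schwartzMul f g) ≤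
      C * (besov χ (Module.finrank ℝ V / p) p f * besov χ s p g) := by
  set α : ℝ := Module.finrank ℝ V / p
  refine ⟨2 * (∑' n, interaction (s + α) n) * productBlockConst χ p s,
    ENNReal.mul_ne_top (ENNReal.mul_ne_top (by simp) (tsum_interaction_lt_top hs').ne)
      (productBlockConst_ne_top χ hp s), fun f g => ?_⟩
  simp only [besov_eq]
  set A : ℤ → ℝ≥0∞ := fun j =>
    2 ^ (α * j) * eLpNorm (χ.blockS j f) (ENNReal.ofReal p) volume
  set B : ℤ → ℝ≥0∞ := fun k =>
    2 ^ (s * k) * eLpNorm (χ.blockS k g) (ENNReal.ofReal p) volume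
  set I := ∑' n, interaction (s + α) n with hI
  have hshift : ∀ j : ℤ, ∑' m : ℤ, interaction (s + α) (m - j) = I := fun j =>
    (Equiv.subRight j).tsum_eq (interaction (s + α))
  calc _ ≤ ∑' m : ℤ, ∑' j : ℤ, ∑' k : ℤ, (interaction (s + α) (m - j) +
        interaction (s + α) (m - k)) * (productBlockConst χ p s * (A j * B k)) := by
        refine ENNReal.tsum_le_tsum fun m => ?_
        refine (mul_le_mul_right (χ.eLpNorm_blockS_mul_le m f g (by linarith)) _).trans ?_
        simp only [← ENNReal.tsum_mul_left]
        exact ENNReal.tsum_le_tsum fun j => ENNReal.tsum_le_tsum fun k =>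
          product_block χ hp hs j k m f g
    _ = ∑' j : ℤ, ∑' k : ℤ, ∑' m : ℤ, (interaction (s + α) (m - j) +
        interaction (s + α) (m - k)) * (productBlockConst χ p s * (A j * B k)) := by
        rw [ENNReal.tsum_comm]
        exact tsum_congr fun j => ENNReal.tsum_comm
    _ = ∑' j : ℤ, ∑' k : ℤ, (2 * I * productBlockConst χ p s) * (A j * B k) := by
        refine tsum_congr fun j => tsum_congr fun k => ?_
        rw [ENNReal.tsum_mul_right, ENNReal.tsum_add, hshift, hshift]
        ring
    _ = _ := by
        simp only [ENNReal.tsum_mul_left, ENNReal.tsum_mul_right]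

end Product

end MHD

namespace MHD

open FourierTransform SchwartzMap LineDeriv

section Derivatives

variable {N : ℕ}

namespace LPF

lemma psiS_eq_zero_of_le (χ : LPF (Euc N)) {ξ : Euc N} (h : ‖ξ‖ ≤ 2⁻¹) : χ.psiS ξ = 0 := by
  rw [psiS_apply, χ.eq_one, χ.eq_one]
  · simp
  · rw [norm_smul]; norm_num; linarith
  · rw [norm_smul]; norm_num; linarith

lemma psiS_eq_zero_of_ge (χ : LPF (Euc N)) {ξ : Euc N} (h : 8 ≤ ‖ξ‖) : χ.psiS ξ = 0 := by
  rw [psiS_apply, χ.supp, χ.supp]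
  · simp
  · rw [norm_smul]; norm_num; linarith
  · rw [norm_smul]; norm_num; linarith

/-- The symbol of the inverse gradient, localized to an annulus. -/
def invGradFun (χ : LPF (Euc N)) (l : Fin N) (ξ : Euc N) : ℂ :=
  χ.psiS ξ * (((ξ l / ‖ξ‖ ^ 2 : ℝ) : ℂ) / (2 * Real.pi * Complex.I))

lemma contDiff_invGradFun (χ : LPF (Euc N)) (l : Fin N) :
    ContDiff ℝ (⊤ : ℕ∞) (χ.invGradFun l) := by
  rw [contDiff_iff_contDiffAt]
  intro ξ
  rcases eq_or_ne ξ 0 with rfl | hξ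
  · refine contDiffAt_const (c := (0 : ℂ)) |>.congr_of_eventuallyEq ?_
    filter_upwards [Metric.ball_mem_nhds (0 : Euc N) (show (0 : ℝ) < 2⁻¹ by norm_num)] with x hx
    rw [invGradFun, χ.psiS_eq_zero_of_le (by simpa using (mem_ball_zero_iff.1 hx).le), zero_mul]
  · refine (χ.psiS.smooth ⊤).contDiffAt.mul (ContDiffAt.div_const ?_ _)
    refine Complex.ofRealCLM.contDiff.contDiffAt.comp ξ ?_
    refine ContDiffAt.div ?_ (contDiff_norm_sq ℝ).contDiffAt (by simpa using hξ)
    exact (EuclideanSpace.proj (𝕜 := ℝ) l).contDiff.contDiffAt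

lemma hasCompactSupport_invGradFun (χ : LPF (Euc N)) (l : Fin N) :
    HasCompactSupport (χ.invGradFun l) := by
  refine HasCompactSupport.intro (isCompact_closedBall (0 : Euc N) 8) fun x hx => ?_
  rw [Metric.mem_closedBall, dist_zero_right, not_le] at hx
  rw [invGradFun, χ.psiS_eq_zero_of_ge hx.le, zero_mul]

/-- The symbol of the localized inverse gradient as a Schwartz function. -/
def invGrad (χ : LPF (Euc N)) (l : Fin N) : 𝓢(Euc N, ℂ) :=
  (χ.hasCompactSupport_invGradFun l).toSchwartzMap (χ.contDiff_invGradFun l)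

lemma invGrad_apply (χ : LPF (Euc N)) (l : Fin N) (ξ : Euc N) :
    χ.invGrad l ξ = χ.psiS ξ * (((ξ l / ‖ξ‖ ^ 2 : ℝ) : ℂ) / (2 * Real.pi * Complex.I)) := rfl

lemma sum_invGrad (χ : LPF (Euc N)) (ξ : Euc N) :
    ∑ l, χ.invGrad l ξ * (2 * Real.pi * Complex.I * ξ l) = χ.psiS ξ := by
  rcases eq_or_ne ξ 0 with rfl | hξ
  · simp [χ.psiS_eq_zero_of_le (ξ := 0) (by simp)]
  have h : ∀ l, χ.invGrad l ξ * (2 * Real.pi * Complex.I * ξ l) =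
      χ.psiS ξ * ((ξ l ^ 2 / ‖ξ‖ ^ 2 : ℝ) : ℂ) := fun l => by
    have hpi : (Real.pi : ℂ) ≠ 0 := by exact_mod_cast Real.pi_ne_zero
    have hn : (‖ξ‖ : ℂ) ≠ 0 := by exact_mod_cast norm_ne_zero_iff.2 hξ
    rw [invGrad_apply]
    push_cast
    field_simp
  simp only [h]
  rw [← Finset.mul_sum, ← Complex.ofReal_sum, ← Finset.sum_div, ← EuclideanSpace.real_norm_sq_eq,
    div_self (by simpa using hξ)]
  simp

lemma fourier_lineDeriv (g : 𝓢(Euc N, ℂ)) (l : Fin N) (ξ : Euc N) :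
    𝓕 (∂_{EuclideanSpace.single l (1 : ℝ)} g) ξ = (2 * Real.pi * Complex.I * ξ l) * 𝓕 g ξ := by
  rw [SchwartzMap.fourier_lineDerivOp_eq, _root_.smul_apply,
    smulLeftCLM_apply_apply (by fun_prop)]
  simp [EuclideanSpace.inner_single_right]
  ring

lemma blockS_eq_sum_lineDeriv (χ : LPF (Euc N)) (k : ℤ) (g : 𝓢(Euc N, ℂ)) :
    χ.blockS k g = ((2 : ℝ) ^ (-k) : ℂ) • ∑ l, dyadicMul k (χ.invGrad l)
      (χ.blockS k (∂_{EuclideanSpace.single l (1 : ℝ)} g)) := by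
  refine ext_fourier fun ξ => ?_
  have h : ∀ (c : ℂ) (F : Fin N → 𝓢(Euc N, ℂ)), 𝓕 (c • ∑ l, F l) ξ = c * ∑ l, 𝓕 (F l) ξ :=
    fun c F => by
    have := (fourierCLM ℂ 𝓢(Euc N, ℂ)).map_smul c (∑ l, F l)
    rw [map_sum] at this
    have h2 := congrArg (fun G : 𝓢(Euc N, ℂ) => G ξ) this
    simp only [sum_apply, _root_.smul_apply, smul_eq_mul, fourierCLM_apply] at h2
    exact h2
  rw [h]
  simp only [blockS, fourier_dyadicMul, fourier_lineDeriv]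
  conv_lhs => rw [← χ.psiS_mul_phiS, ← χ.sum_invGrad]
  simp only [Finset.sum_mul, Finset.mul_sum]
  refine Finset.sum_congr rfl fun l _ => ?_
  simp only [PiLp.smul_apply, smul_eq_mul]
  push_cast
  ring

end LPF

/-- The constant in the control of `Δ̇_k g` by `Δ̇_k ∇g`. -/
def gradConst (χ : LPF (Euc N)) : ℝ≥0∞ := ∑ l, kernelBound (χ.invGrad l)

lemma gradConst_ne_top (χ : LPF (Euc N)) : gradConst χ ≠ ∞ :=
  ENNReal.sum_ne_top.2 fun _ _ => kernelBound_ne_top _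

lemma besov_add_one_le (χ : LPF (Euc N)) (s : ℝ) {p : ℝ} (hp : 1 ≤ p) (g : 𝓢(Euc N, ℂ)) :
    besov χ (s + 1) p g ≤
      gradConst χ * ∑ l : Fin N, besov χ s p
        (∂_{EuclideanSpace.single l (1 : ℝ)} g : 𝓢(Euc N, ℂ)) := by
  have hp' : 1 ≤ ENNReal.ofReal p := by simpa using hp
  have hterm : ∀ k : ℤ, (2 : ℝ≥0∞) ^ ((s + 1) * k) *
      eLpNorm (χ.blockS k g) (ENNReal.ofReal p) volume ≤
      ∑ l : Fin N, gradConst χ * ((2 : ℝ≥0∞) ^ (s * k) * eLpNorm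
        (χ.blockS k (∂_{EuclideanSpace.single l (1 : ℝ)} g)) (ENNReal.ofReal p) volume) := by
    intro k
    have e : ‖((2 : ℝ) ^ (-k) : ℂ)‖ₑ = (2 : ℝ≥0∞) ^ (-(k : ℝ)) := by
      rw [← ofReal_norm, norm_zpow, Complex.norm_real, Real.norm_ofNat, ← Real.rpow_intCast,
        ← ENNReal.ofReal_rpow_of_pos two_pos]
      simp
    have hsum : ∀ F : Fin N → 𝓢(Euc N, ℂ), eLpNorm (⇑(∑ l : Fin N, F l))
        (ENNReal.ofReal p) volume ≤
        ∑ l, eLpNorm (F l) (ENNReal.ofReal p) volume := fun F => by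
      rw [show ⇑(∑ l : Fin N, F l) = ∑ l : Fin N, ⇑(F l) by ext x; simp [sum_apply]]
      exact eLpNorm_sum_le (fun l _ => (F l).continuous.aestronglyMeasurable) hp'
    have hc : (2 : ℝ≥0∞) ^ ((s + 1) * k) * 2 ^ (-(k : ℝ)) = 2 ^ (s * k) := by
      rw [← two_rpow_add]; congr 1; ring
    rw [χ.blockS_eq_sum_lineDeriv, FunLike.coe_smul, eLpNorm_const_smul, e, ← mul_assoc, hc]
    refine (mul_le_mul_right (hsum _) _).trans ?_
    simp only [Finset.mul_sum]
    refine Finset.sum_le_sum fun l _ => ?_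
    rw [mul_left_comm]
    gcongr
    refine (eLpNorm_dyadicMul_le k (χ.invGrad l) _ hp le_rfl).trans ?_
    simp only [sub_self, mul_zero, ENNReal.rpow_zero, mul_one]
    gcongr
    exact Finset.single_le_sum (f := fun l => kernelBound (χ.invGrad l)) (fun _ _ => zero_le)
      (Finset.mem_univ l)
  simp only [besov_eq]
  refine (ENNReal.tsum_le_tsum hterm).trans (le_of_eq ?_)
  rw [Summable.tsum_finsetSum (fun _ _ => ENNReal.summable), Finset.mul_sum]
  simp only [ENNReal.tsum_mul_left]

end Derivatives

end MHD

namespace MHD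

open Set Filter

section TimeDependent

variable {N : ℕ} {F G : Type} [NormedAddCommGroup F] [NormedSpace ℝ F]
  [NormedAddCommGroup G] [NormedSpace ℝ G]

namespace SmoothCpt

lemma eq_zero {w : ℝ → Euc N → F} (hw : SmoothCpt N w) {t : ℝ} (ht : t ≤ 0) (y : Euc N) :
    w t y = 0 := hw.2.2 t ht y

lemma contDiff_slice {w : ℝ → Euc N → F} (hw : SmoothCpt N w) (t : ℝ) :
    ContDiff ℝ (⊤ : ℕ∞) (w t) :=
  hw.1.comp (contDiff_prodMk_right t)

lemma exists_isCompact {w : ℝ → Euc N → F} (hw : SmoothCpt N w) :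
    ∃ K : Set (Euc N), IsCompact K ∧ ∀ t, ∀ y ∉ K, w t y = 0 := by
  refine ⟨Prod.snd '' tsupport (Function.uncurry w), hw.2.1.isCompact.image continuous_snd,
    fun t y hy => ?_⟩
  by_contra h
  exact hy ⟨(t, y), subset_tsupport _ h, rfl⟩

lemma hasCompactSupport_slice {w : ℝ → Euc N → F} (hw : SmoothCpt N w) (t : ℝ) :
    HasCompactSupport (w t) := by
  obtain ⟨K, hK, h⟩ := hw.exists_isCompact
  exact HasCompactSupport.intro hK fun y hy => h t y hy

lemma clm_comp {w : ℝ → Euc N → F} (hw : SmoothCpt N w) (L : F →L[ℝ] G) :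
    SmoothCpt N fun t y => L (w t y) :=
  ⟨L.contDiff.comp hw.1, hw.2.1.comp_left (map_zero L), fun t ht y => by simp [hw.eq_zero ht]⟩

lemma hasFDerivAt_slice {w : ℝ → Euc N → F} (hw : SmoothCpt N w) (t : ℝ) (y : Euc N) :
    HasFDerivAt (w t) (fderiv ℝ (w t) y) y :=
  ((hw.contDiff_slice t).differentiable (by simp) y).hasFDerivAt

lemma fderiv_slice {w : ℝ → Euc N → F} (hw : SmoothCpt N w) (t : ℝ) (y : Euc N) :
    fderiv ℝ (w t) y =
      (fderiv ℝ (Function.uncurry w) (t, y)).comp (ContinuousLinearMap.inr ℝ ℝ (Euc N)) := by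
  have h1 : HasFDerivAt (Function.uncurry w) (fderiv ℝ (Function.uncurry w) (t, y)) (t, y) :=
    (hw.1.differentiable (by simp) _).hasFDerivAt
  exact (h1.comp y (hasFDerivAt_prodMk_right t y)).fderiv

lemma fderiv {w : ℝ → Euc N → F} (hw : SmoothCpt N w) :
    SmoothCpt N fun t y => fderiv ℝ (w t) y := by
  have e : Function.uncurry (fun t y => _root_.fderiv ℝ (w t) y) = fun z =>
      (_root_.fderiv ℝ (Function.uncurry w) z).comp (ContinuousLinearMap.inr ℝ ℝ (Euc N)) := by
    ext1 ⟨t, y⟩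
    exact hw.fderiv_slice t y
  refine ⟨?_, ?_, fun t ht y => ?_⟩
  · rw [e]
    exact (hw.1.fderiv_right (m := (⊤ : ℕ∞)) (by simp)).clm_comp contDiff_const
  · rw [e]
    exact (hw.2.1.fderiv (𝕜 := ℝ)).comp_left
      (g := fun A => A.comp (ContinuousLinearMap.inr ℝ ℝ (Euc N))) (by simp)
  · have : w t = fun _ => 0 := funext fun y => hw.eq_zero ht y
    simp [this]

lemma pdv {w : ℝ → Euc N → F} (hw : SmoothCpt N w) (i : Fin N) :
    SmoothCpt N fun t y => pdv i (w t) y :=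
  hw.fderiv.clm_comp (ContinuousLinearMap.apply ℝ F (EuclideanSpace.single i 1))

lemma pdv_clm {w : ℝ → Euc N → F} (hw : SmoothCpt N w) (L : F →L[ℝ] G) (i : Fin N) (t : ℝ)
    (y : Euc N) : MHD.pdv i (fun z => L (w t z)) y = L (MHD.pdv i (w t) y) := by
  have := (L.hasFDerivAt.comp y (hw.hasFDerivAt_slice t y)).fderiv
  simp only [MHD.pdv]
  exact congrArg (fun A => A (EuclideanSpace.single i 1)) this

lemma continuous {w : ℝ → Euc N → F} (hw : SmoothCpt N w) :
    Continuous (Function.uncurry w) := hw.1.continuous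

lemma exists_bound {w : ℝ → Euc N → F} (hw : SmoothCpt N w) : ∃ C, ∀ t y, ‖w t y‖ ≤ C := by
  obtain ⟨C, hC⟩ := hw.continuous.bounded_above_of_compact_support hw.2.1
  exact ⟨C, fun t y => hC (t, y)⟩

lemma continuous_time {w : ℝ → Euc N → F} (hw : SmoothCpt N w) (y : Euc N) :
    Continuous fun τ => w τ y :=
  hw.continuous.comp (by fun_prop : Continuous fun τ : ℝ => (τ, y))

end SmoothCpt

/-- The time primitive `∫₀ᵗ w(τ,·) dτ`. -/
def timePrim (w : ℝ → Euc N → F) (t : ℝ) (y : Euc N) : F := ∫ τ in (0 : ℝ)..t, w τ y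

namespace SmoothCpt

lemma hasFDerivAt_timePrim {w : ℝ → Euc N → F} (hw : SmoothCpt N w) (t : ℝ) (y : Euc N) :
    HasFDerivAt (timePrim w t) (timePrim (fun τ z => _root_.fderiv ℝ (w τ) z) t y) y := by
  obtain ⟨C, hC⟩ := hw.fderiv.exists_bound
  exact intervalIntegral.hasFDerivAt_integral_of_dominated_of_fderiv_le (s := univ)
    (bound := fun _ => C) univ_mem
    (Eventually.of_forall fun z => (hw.continuous_time z).aestronglyMeasurable)
    ((hw.continuous_time y).intervalIntegrable _ _)
    (hw.fderiv.continuous_time y).aestronglyMeasurable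
    (Eventually.of_forall fun τ _ z _ => hC τ z) (by simp)
    (Eventually.of_forall fun τ _ z _ => hw.hasFDerivAt_slice τ z)

lemma contDiff_nat_timePrim (n : ℕ) : ∀ {F : Type} [NormedAddCommGroup F] [NormedSpace ℝ F]
    {w : ℝ → Euc N → F} (_ : SmoothCpt N w) (t : ℝ), ContDiff ℝ n (timePrim w t) := by
  induction n with
  | zero =>
    intro F _ _ w hw t
    exact contDiff_zero.2 (continuous_iff_continuousAt.2
      fun y => (hw.hasFDerivAt_timePrim t y).continuousAt)
  | succ n ih =>
    intro F _ _ w hw t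
    have := contDiff_succ_iff_fderiv (𝕜 := ℝ) (n := n) (f := timePrim w t)
    push_cast
    rw [this]
    refine ⟨fun y => (hw.hasFDerivAt_timePrim t y).differentiableAt, by simp, ?_⟩
    rw [show _root_.fderiv ℝ (timePrim w t) = timePrim (fun τ z => _root_.fderiv ℝ (w τ) z) t from
      funext fun y => (hw.hasFDerivAt_timePrim t y).fderiv]
    exact ih hw.fderiv t

lemma contDiff_timePrim {w : ℝ → Euc N → F} (hw : SmoothCpt N w) (t : ℝ) :
    ContDiff ℝ (⊤ : ℕ∞) (timePrim w t) :=
  contDiff_infty.2 fun n => contDiff_nat_timePrim n hw t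

lemma hasCompactSupport_timePrim {w : ℝ → Euc N → F} (hw : SmoothCpt N w) (t : ℝ) :
    HasCompactSupport (timePrim w t) := by
  obtain ⟨K, hK, h⟩ := hw.exists_isCompact
  refine HasCompactSupport.intro hK fun y hy => ?_
  simp [timePrim, h _ y hy]

lemma pdv_timePrim [CompleteSpace F] {w : ℝ → Euc N → F} (hw : SmoothCpt N w) (i : Fin N) (t : ℝ)
    (y : Euc N) :
    MHD.pdv i (timePrim w t) y = timePrim (fun τ z => MHD.pdv i (w τ) z) t y := by
  rw [MHD.pdv, (hw.hasFDerivAt_timePrim t y).fderiv, timePrim, timePrim]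
  exact (ContinuousLinearMap.intervalIntegral_apply
    ((hw.fderiv.continuous_time y).intervalIntegrable _ _) _)

end SmoothCpt

end TimeDependent

end MHD

namespace MHD

open Set Filter SchwartzMap LineDeriv

section TimeIntegral

variable {N : ℕ} {w : ℝ → Euc N → ℂ}

namespace SmoothCpt

/-- The time slice `w(t,·)` as a Schwartz function. -/
def slice (hw : SmoothCpt N w) (t : ℝ) : 𝓢(Euc N, ℂ) :=
  (hw.hasCompactSupport_slice t).toSchwartzMap (hw.contDiff_slice t)

@[simp]
lemma coe_slice (hw : SmoothCpt N w) (t : ℝ) : ⇑(hw.slice t) = w t := rfl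

/-- The time primitive `∫₀ᵗ w(τ,·) dτ` as a Schwartz function. -/
def prim (hw : SmoothCpt N w) (t : ℝ) : 𝓢(Euc N, ℂ) :=
  (hw.hasCompactSupport_timePrim t).toSchwartzMap (hw.contDiff_timePrim t)

@[simp]
lemma coe_prim (hw : SmoothCpt N w) (t : ℝ) : ⇑(hw.prim t) = timePrim w t := rfl

lemma lineDeriv_prim (hw : SmoothCpt N w) (t : ℝ) (l : Fin N) :
    (∂_{EuclideanSpace.single l (1 : ℝ)} (hw.prim t) : 𝓢(Euc N, ℂ)) = (hw.pdv l).prim t := by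
  ext y
  rw [SchwartzMap.lineDerivOp_apply_eq_fderiv]
  exact hw.pdv_timePrim l t y

lemma continuous_blockS (hw : SmoothCpt N w) (χ : LPF (Euc N)) (k : ℤ) :
    Continuous fun z : ℝ × Euc N => χ.blockS k (hw.slice z.1) z.2 := by
  obtain ⟨K, hK, h⟩ := hw.exists_isCompact
  simp only [LPF.blockS, dyadicMul_apply, coe_slice]
  have e : ∀ z : ℝ × Euc N, ∫ y, dyadicKernel k χ.phiS (z.2 - y) * w z.1 y =
      ∫ y in K, dyadicKernel k χ.phiS (z.2 - y) * w z.1 y := fun z => by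
    refine (setIntegral_eq_integral_of_forall_compl_eq_zero fun y hy => ?_).symm
    rw [h _ y hy, mul_zero]
  simp only [e]
  refine continuous_parametric_integral_of_continuous (X := ℝ × Euc N)
    (f := fun z y => dyadicKernel k χ.phiS (z.2 - y) * w z.1 y) ?_ hK
  refine Continuous.mul ?_ ?_
  · exact (dyadicKernel k χ.phiS).continuous.comp (by fun_prop)
  · exact hw.continuous.comp (by fun_prop : Continuous fun x : (ℝ × Euc N) × Euc N => (x.1.1, x.2))

lemma measurable_eLpNorm_blockS (hw : SmoothCpt N w) (χ : LPF (Euc N)) (k : ℤ) {p : ℝ}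
    (hp : 0 < p) :
    Measurable fun t => eLpNorm (χ.blockS k (hw.slice t)) (ENNReal.ofReal p) volume := by
  simp only [eLpNorm_ofReal hp]
  refine Measurable.pow_const ?_ _
  refine Measurable.lintegral_prod_right' (f := fun z : ℝ × Euc N =>
    ‖χ.blockS k (hw.slice z.1) z.2‖ₑ ^ p) ?_
  exact ((hw.continuous_blockS χ k).measurable.enorm).pow_const _

lemma measurable_besov (hw : SmoothCpt N w) (χ : LPF (Euc N)) (s : ℝ) {p : ℝ} (hp : 0 < p) :
    Measurable fun t => besov χ s p (w t) := by
  have e : ∀ t, besov χ s p (w t) = besov χ s p (hw.slice t) := fun t => rfl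
  simp only [e, besov_eq]
  exact Measurable.tsum fun k =>
    (hw.measurable_eLpNorm_blockS χ k hp).const_mul _

lemma blockS_prim (hw : SmoothCpt N w) (χ : LPF (Euc N)) (k : ℤ) {t : ℝ} (ht : 0 ≤ t)
    (x : Euc N) :
    χ.blockS k (hw.prim t) x = ∫ τ in Ioc 0 t, χ.blockS k (hw.slice τ) x := by
  simp only [LPF.blockS, dyadicMul_apply, coe_slice, coe_prim, timePrim,
    intervalIntegral.integral_of_le ht, ← integral_const_mul]
  refine integral_integral_swap ?_
  have hc : Continuous (Function.uncurry fun (y : Euc N) (τ : ℝ) =>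
      dyadicKernel k χ.phiS (x - y) * w τ y) := by
    refine Continuous.mul ?_ ?_
    · exact (dyadicKernel k χ.phiS).continuous.comp (by fun_prop)
    · exact hw.continuous.comp (by fun_prop : Continuous fun z : Euc N × ℝ => (z.2, z.1))
  have hs : HasCompactSupport (Function.uncurry fun (y : Euc N) (τ : ℝ) =>
      dyadicKernel k χ.phiS (x - y) * w τ y) := by
    have := hw.2.1.comp_homeomorph (Homeomorph.prodComm (Euc N) ℝ)
    exact this.mul_left (f := fun z : Euc N × ℝ => dyadicKernel k χ.phiS (x - z.1))
  have hi : Integrable (Function.uncurry fun (y : Euc N) (τ : ℝ) =>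
      dyadicKernel k χ.phiS (x - y) * w τ y) (volume.prod volume) :=
    hc.integrable_of_hasCompactSupport hs
  have hm : (volume : Measure (Euc N)).prod ((volume : Measure ℝ).restrict (Ioc 0 t)) ≤
      volume.prod volume := by
    conv_lhs => rw [← Measure.restrict_univ (μ := (volume : Measure (Euc N)))]
    rw [Measure.prod_restrict]
    exact Measure.restrict_le_self
  exact hi.mono_measure hm

lemma eLpNorm_blockS_prim_le (hw : SmoothCpt N w) (χ : LPF (Euc N)) (k : ℤ) {t p : ℝ}
    (ht : 0 ≤ t) (hp : 1 ≤ p) :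
    eLpNorm (χ.blockS k (hw.prim t)) (ENNReal.ofReal p) volume ≤
      ∫⁻ τ in Ioi 0, eLpNorm (χ.blockS k (hw.slice τ)) (ENNReal.ofReal p) volume := by
  have hp0 : 0 < p := by linarith
  simp only [eLpNorm_ofReal hp0]
  refine le_trans ?_ (lintegral_lintegral_rpow_le (μ := (volume : Measure (Euc N)))
    (ν := volume.restrict (Ioi (0 : ℝ))) (f := fun τ x => ‖χ.blockS k (hw.slice τ) x‖ₑ)
    (hw.continuous_blockS χ k).measurable.enorm hp)
  gcongr with x
  rw [hw.blockS_prim χ k ht]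
  exact (enorm_integral_le_lintegral_enorm _).trans (lintegral_mono_set Ioc_subset_Ioi_self)

lemma besov_prim_le (hw : SmoothCpt N w) (χ : LPF (Euc N)) (s : ℝ) {t p : ℝ} (ht : 0 ≤ t)
    (hp : 1 ≤ p) : besov χ s p (hw.prim t) ≤ besovT χ s p (Ioi 0) w := by
  have e : ∀ t, besov χ s p (w t) = besov χ s p (hw.slice t) := fun t => rfl
  simp only [besovT, e, besov_eq]
  rw [lintegral_tsum fun k =>
    ((hw.measurable_eLpNorm_blockS χ k (by linarith)).const_mul _).aemeasurable]
  refine ENNReal.tsum_le_tsum fun k => ?_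
  rw [lintegral_const_mul _ (hw.measurable_eLpNorm_blockS χ k (by linarith))]
  gcongr
  exact hw.eLpNorm_blockS_prim_le χ k ht hp

lemma besov_add_one_prim_le (hw : SmoothCpt N w) (χ : LPF (Euc N)) (s : ℝ) {t p : ℝ}
    (ht : 0 ≤ t) (hp : 1 ≤ p) : besov χ (s + 1) p (hw.prim t) ≤
      gradConst χ * ∑ l : Fin N, besovT χ s p (Ioi 0) fun τ => MHD.pdv l (w τ) := by
  refine (besov_add_one_le χ s hp _).trans ?_
  gcongr with l
  rw [lineDeriv_prim]
  exact (hw.pdv l).besov_prim_le χ s ht hp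

end SmoothCpt

/-- Space-time control of the displacement gradient by `E(u)`. -/
lemma besov_displacement_le (χ : LPF (Euc N)) {u : ℝ → Euc N → Euc N} (hu : SmoothCpt N u)
    (s : ℝ) {t p : ℝ} (ht : 0 ≤ t) (hp : 1 ≤ p) (v : Fin N × Fin N) :
    ∃ f : 𝓢(Euc N, ℂ),
      (∀ y, f y = ((∫ τ in (0 : ℝ)..t, pdv v.2 (fun z => u τ z v.1) y : ℝ) : ℂ)) ∧
      besov χ (s + 1) p f ≤ gradConst χ * EE χ s p u := by
  have h1 : SmoothCpt N fun t y => u t y v.1 :=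
    hu.clm_comp (EuclideanSpace.proj (𝕜 := ℝ) v.1)
  have h2 := h1.pdv v.2
  have h3 := h2.clm_comp Complex.ofRealCLM
  refine ⟨h3.prim t, fun y => intervalIntegral.integral_ofReal, ?_⟩
  refine (h3.besov_add_one_prim_le χ s ht hp).trans ?_
  gcongr
  have e : ∀ l : Fin N, besovT χ s p (Ioi 0)
      (fun τ => pdv l fun y => Complex.ofRealCLM (pdv v.2 (fun z => u τ z v.1) y)) =
      besovT χ s p (Ioi 0) (fun t y => ((pdv l (pdv v.2 fun z => u t z v.1) y : ℝ) : ℂ)) :=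
    fun l => by
    congr 1
    funext τ y
    exact h2.pdv_clm Complex.ofRealCLM l τ y
  simp only [e]
  rw [EE]
  refine le_trans ?_ (Finset.single_le_sum (f := fun m : Fin N => ∑ i : Fin N, ∑ j : Fin N,
    besovT χ s p (Ioi 0) (fun t y => ((pdv i (pdv j fun z => u t z m) y : ℝ) : ℂ)))
    (fun _ _ => zero_le) (Finset.mem_univ v.1))
  refine Finset.sum_le_sum fun l _ => ?_
  exact Finset.single_le_sum (f := fun j : Fin N =>
    besovT χ s p (Ioi 0) (fun t y => ((pdv l (pdv j fun z => u t z v.1) y : ℝ) : ℂ)))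
    (fun _ _ => zero_le) (Finset.mem_univ v.2)

end TimeIntegral

end MHD

namespace MHD

open SchwartzMap Set

namespace IsCofactorPoly

variable {N : ℕ} {Q : Fin N → Fin N → MvPolynomial (Fin N × Fin N) ℝ}

/-- The generic matrix `1 + X`. -/
def genericMatrix (N : ℕ) : Matrix (Fin N) (Fin N) (MvPolynomial (Fin N × Fin N) ℝ) :=
  1 + Matrix.of fun i j => MvPolynomial.X (i, j)

lemma totalDegree_genericMatrix_le (i j : Fin N) : (genericMatrix N i j).totalDegree ≤ 1 := by
  rw [genericMatrix, Matrix.add_apply, Matrix.of_apply]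
  refine (MvPolynomial.totalDegree_add _ _).trans (max_le ?_ (by simp))
  rw [Matrix.one_apply]
  split_ifs <;> simp

lemma totalDegree_det_le {n : ℕ} {σ : Type*} (A : Matrix (Fin n) (Fin n) (MvPolynomial σ ℝ))
    (h : ∀ i j, (A i j).totalDegree ≤ 1) : A.det.totalDegree ≤ n := by
  rw [Matrix.det_apply]
  refine MvPolynomial.totalDegree_finsetSum_le fun τ _ => ?_
  refine (MvPolynomial.totalDegree_smul_le _ _).trans
    ((MvPolynomial.totalDegree_finsetProd _ _).trans ?_)
  refine (Finset.sum_le_sum fun i _ => h _ _).trans (by simp)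

lemma totalDegree_adjugate_le (i j : Fin N) :
    ((genericMatrix N).adjugate i j).totalDegree ≤ N - 1 := by
  obtain _ | n := N
  · exact i.elim0
  rw [Matrix.adjugate_fin_succ_eq_det_submatrix]
  refine (MvPolynomial.totalDegree_mul _ _).trans ?_
  have h1 : ((-1 : MvPolynomial (Fin (n + 1) × Fin (n + 1)) ℝ) ^ (j + i : ℕ)).totalDegree = 0 := by
    rcases neg_one_pow_eq_or (MvPolynomial (Fin (n + 1) × Fin (n + 1)) ℝ) (j + i : ℕ) with h | h <;>
      simp [h]
  rw [h1, zero_add]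
  exact totalDegree_det_le _ fun a b => totalDegree_genericMatrix_le _ _

lemma eq_adjugate_sub (hQ : IsCofactorPoly N Q) (i j : Fin N) :
    Q i j = (genericMatrix N).adjugate i j - MvPolynomial.C (if i = j then 1 else 0) := by
  refine MvPolynomial.funext fun x => ?_
  have h := (hQ i j).2 (Matrix.of fun a b => x (a, b))
  have h2 : MvPolynomial.eval x ((genericMatrix N).adjugate i j) =
      Matrix.adjugate (1 + Matrix.of fun a b => x (a, b)) i j := by
    have h3 := congrFun (congrFun ((MvPolynomial.eval x).map_adjugate (genericMatrix N)) i) j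
    rw [RingHom.mapMatrix_apply, Matrix.map_apply] at h3
    rw [h3]
    congr 1
    ext a b
    simp [genericMatrix, Matrix.one_apply, apply_ite]
  rw [map_sub, h2, h]
  simp

lemma totalDegree_le (hQ : IsCofactorPoly N Q) (i j : Fin N) : (Q i j).totalDegree ≤ N - 1 := by
  rw [hQ.eq_adjugate_sub, sub_eq_add_neg, ← map_neg]
  exact (MvPolynomial.totalDegree_add _ _).trans
    (max_le (totalDegree_adjugate_le i j) ((MvPolynomial.totalDegree_C _).le.trans (Nat.zero_le _)))

lemma card_mem_Icc (hQ : IsCofactorPoly N Q) {i j : Fin N} {d : Fin N × Fin N →₀ ℕ}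
    (hd : d ∈ (Q i j).support) : Multiset.card (Finsupp.toMultiset d) ∈ Finset.Icc 1 (N - 1) := by
  rw [Finset.mem_Icc]
  constructor
  · rw [Nat.one_le_iff_ne_zero, Ne, Multiset.card_eq_zero]
    intro h
    obtain rfl : d = 0 := by
      classical
      rw [← Finsupp.toMultiset_toFinsupp d, h, map_zero]
    exact MvPolynomial.mem_support_iff.1 hd (hQ i j).1
  · rw [Finsupp.card_toMultiset]
    exact (MvPolynomial.le_totalDegree hd).trans (hQ.totalDegree_le i j)

end IsCofactorPoly

section Algebra

variable {V : Type*} [NormedAddCommGroup V] [InnerProductSpace ℝ V]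
    [FiniteDimensional ℝ V] [MeasurableSpace V] [BorelSpace V]

lemma besov_sum_smul_le (χ : LPF V) (s : ℝ) {p : ℝ} (hp : 1 ≤ p) {ι : Type*} (S : Finset ι)
    (c : ι → ℂ) (F : ι → 𝓢(V, ℂ)) :
    besov χ s p (⇑(∑ i ∈ S, c i • F i)) ≤ ∑ i ∈ S, ‖c i‖ₑ * besov χ s p (F i) := by
  have hp' : 1 ≤ ENNReal.ofReal p := by simpa using hp
  simp only [besov_eq, ← ENNReal.tsum_mul_left]
  rw [← Summable.tsum_finsetSum fun _ _ => ENNReal.summable]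
  refine ENNReal.tsum_le_tsum fun k => ?_
  have e : ⇑(χ.blockS k (∑ i ∈ S, c i • F i)) = ∑ i ∈ S, c i • ⇑(χ.blockS k (F i)) := by
    ext x
    simp [map_sum, sum_apply]
  rw [e]
  refine (mul_le_mul_right (eLpNorm_sum_le (fun i _ =>
    ((χ.blockS k (F i)).continuous.const_smul (c i)).aestronglyMeasurable) hp') _).trans ?_
  rw [Finset.mul_sum]
  refine Finset.sum_le_sum fun i _ => ?_
  rw [eLpNorm_const_smul, mul_left_comm]

lemma exists_multiset_prod (χ : LPF V) {p s : ℝ} {C : ℝ≥0∞} (hC1 : 1 ≤ C)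
    (hC : ∀ f g : 𝓢(V, ℂ), besov χ s p (schwartzMul f g) ≤ C * (besov χ s p f * besov χ s p g))
    {ι : Type*} (G : ι → 𝓢(V, ℂ)) {X : ℝ≥0∞} (hG : ∀ v, besov χ s p (G v) ≤ X)
    (m : Multiset ι) (hm : m ≠ 0) :
    ∃ f : 𝓢(V, ℂ), (∀ y, f y = (m.map fun v => G v y).prod) ∧
      besov χ s p f ≤ (C * X) ^ Multiset.card m := by
  induction m using Multiset.induction_on with
  | empty => exact absurd rfl hm
  | cons a m ih =>
    rcases eq_or_ne m 0 with rfl | hm'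
    · refine ⟨G a, by simp, ?_⟩
      simpa using (hG a).trans (le_mul_of_one_le_left' hC1)
    · obtain ⟨f, hf, hb⟩ := ih hm'
      refine ⟨schwartzMul (G a) f, fun y => by simp [hf], (hC _ _).trans ?_⟩
      rw [Multiset.card_cons, pow_succ', mul_assoc]
      gcongr
      exact hG a

/-- The constant bounding a polynomial nonlinearity. -/
def polyConst {ι : Type*} (P : MvPolynomial ι ℝ) (K : ℝ≥0∞) (n : ℕ) : ℝ≥0∞ :=
  (∑ d ∈ P.support, ‖((P.coeff d : ℝ) : ℂ)‖ₑ) * (1 + K) ^ n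

lemma polyConst_ne_top {ι : Type*} (P : MvPolynomial ι ℝ) {K : ℝ≥0∞} (hK : K ≠ ∞) (n : ℕ) :
    polyConst P K n ≠ ∞ :=
  ENNReal.mul_ne_top (ENNReal.sum_ne_top.2 fun _ _ => by simp)
    (ENNReal.pow_ne_top (ENNReal.add_ne_top.2 ⟨by simp, hK⟩))

lemma exists_poly (χ : LPF V) {p s : ℝ} (hp : 1 ≤ p) {C : ℝ≥0∞} (hC1 : 1 ≤ C)
    (hC : ∀ f g : 𝓢(V, ℂ), besov χ s p (schwartzMul f g) ≤ C * (besov χ s p f * besov χ s p g))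
    {ι : Type*} (P : MvPolynomial ι ℝ) {n : ℕ}
    (hP : ∀ d ∈ P.support, Multiset.card (Finsupp.toMultiset d) ∈ Finset.Icc 1 n)
    (g : ι → V → ℝ) {A E : ℝ≥0∞}
    (hg : ∀ v, ∃ f : 𝓢(V, ℂ), (∀ y, f y = (g v y : ℂ)) ∧ besov χ s p f ≤ A * E) :
    ∃ f : 𝓢(V, ℂ), (∀ y, f y = (MvPolynomial.eval (fun v => g v y) P : ℝ)) ∧
      besov χ s p f ≤ polyConst P (C * A) n * ∑ r ∈ Finset.Icc 1 n, E ^ r := by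
  choose G hG hGb using hg
  have hd : ∀ d : P.support, (Finsupp.toMultiset (d : ι →₀ ℕ)) ≠ 0 := fun d h0 => by
    have := hP d d.2
    rw [h0] at this
    simp at this
  choose M hM hMb using fun d : P.support =>
    exists_multiset_prod χ hC1 hC G hGb (Finsupp.toMultiset (d : ι →₀ ℕ)) (hd d)
  refine ⟨∑ d ∈ P.support.attach, ((P.coeff d : ℝ) : ℂ) • M d, fun y => ?_, ?_⟩
  · rw [MvPolynomial.eval_eq, ← Finset.sum_attach P.support, Complex.ofReal_sum]
    simp only [sum_apply, smul_apply, smul_eq_mul]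
    refine Finset.sum_congr rfl fun d _ => ?_
    rw [hM, Complex.ofReal_mul, Complex.ofReal_prod]
    simp [Finsupp.toMultiset_apply, Finsupp.sum, Multiset.map_nsmul, Multiset.prod_sum, Multiset.prod_nsmul,
      ← Multiset.coe_mapAddMonoidHom, hG]
  · refine (besov_sum_smul_le χ s hp _ _ _).trans ?_
    rw [polyConst, ← Finset.sum_attach P.support, Finset.sum_mul, Finset.sum_mul]
    refine Finset.sum_le_sum fun d _ => ?_
    rw [mul_assoc]
    gcongr
    have hr := hP d d.2
    refine (hMb d).trans ?_
    rw [← mul_assoc, mul_pow]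
    gcongr
    · exact self_le_add_right _ _
    · exact self_le_add_left _ _
    · exact (Finset.mem_Icc.1 hr).2
    · exact Finset.single_le_sum (f := fun r => E ^ r) (fun _ _ => zero_le) hr

end Algebra

end MHD

namespace MHD

lemma besov_V2_component_le {N : ℕ} (hN : 2 ≤ N) {p : ℝ} (hp1 : (N : ℝ) ≤ p)
    (hp2 : p < 2 * N - 1) (χ : LPF (Euc N))
    {Q : Fin N → Fin N → MvPolynomial (Fin N × Fin N) ℝ} (hQ : IsCofactorPoly N Q) :
    ∃ C : Fin N → Fin N → ℝ≥0∞, (∀ i j, C i j ≠ ∞) ∧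
      ∀ u : ℝ → Euc N → Euc N, SmoothCpt N u →
      ∀ q : ℝ → Euc N → ℝ, SmoothCpt N q → ∀ i, ∀ t, 0 < t →
        besov χ (-1 + N / p) p
            (fun y => (((-∑ j : Fin N, Pmat Q u t y j i * pdv j (q t) y : ℝ)) : ℂ)) ≤
          ∑ j, C i j * (∑ r ∈ Finset.Icc 1 (N - 1), EE χ (-1 + N / p) p u ^ r) *
            besov χ (-1 + N / p) p (fun y => ((pdv j (q t) y : ℝ) : ℂ)) := by
  have hN' : (2 : ℝ) ≤ N := by exact_mod_cast hN
  have hp : 2 ≤ p := hN'.trans hp1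
  have hp0 : 0 < p := by linarith
  have : Nonempty (Fin N) := ⟨⟨0, by omega⟩⟩
  have hfr : (Module.finrank ℝ (Euc N) : ℝ) = N := by simp
  have hNp : 0 < (N : ℝ) / p := by positivity
  have hNp2 : 1 < N / p + N / p := by
    rw [← add_div, lt_div_iff₀ hp0]
    linarith
  obtain ⟨C₁, hC₁, hmul₁⟩ := exists_besov_schwartzMul_le χ hp (s := N / p)
    (by rw [hfr]) (by rw [hfr]; linarith)
  obtain ⟨C₂, hC₂, hmul₂⟩ := exists_besov_schwartzMul_le χ hp (s := -1 + N / p)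
    (by rw [hfr]; linarith) (by rw [hfr]; linarith)
  rw [hfr] at hmul₁ hmul₂
  refine ⟨fun i j => C₂ * polyConst (Q j i) ((1 + C₁) * gradConst χ) (N - 1), fun i j =>
    ENNReal.mul_ne_top hC₂ (polyConst_ne_top _ (ENNReal.mul_ne_top
      (ENNReal.add_ne_top.2 ⟨by simp, hC₁⟩) (gradConst_ne_top χ)) _), ?_⟩
  intro u hu q hq i t ht
  have hP : ∀ j, ∃ f : SchwartzMap (Euc N) ℂ, (∀ y, f y = (Pmat Q u t y j i : ℂ)) ∧
      besov χ (N / p) p f ≤ polyConst (Q j i) ((1 + C₁) * gradConst χ) (N - 1) *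
        ∑ r ∈ Finset.Icc 1 (N - 1), EE χ (-1 + N / p) p u ^ r := fun j => by
    refine exists_poly χ (by linarith) le_self_add (fun f g => (hmul₁ f g).trans ?_) (Q j i)
      (fun d hd => hQ.card_mem_Icc hd)
      (fun v y => ∫ τ in (0 : ℝ)..t, pdv v.2 (fun z => u τ z v.1) y) fun v => ?_
    · gcongr
      exact le_add_self
    · have := besov_displacement_le χ hu (-1 + N / p) ht.le (p := p) (by linarith) v
      rwa [show -1 + (N : ℝ) / p + 1 = N / p by ring] at this
  choose f hf hfb using hP
  have hD : ∀ j, SmoothCpt N fun t y => ((pdv j (q t) y : ℝ) : ℂ) := fun j =>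
    (hq.pdv j).clm_comp Complex.ofRealCLM
  have e : (fun y => (((-∑ j : Fin N, Pmat Q u t y j i * pdv j (q t) y : ℝ)) : ℂ)) =
      ⇑(∑ j, (-1 : ℂ) • schwartzMul (f j) ((hD j).slice t)) := by
    ext y
    simp [hf]
  rw [e]
  refine (besov_sum_smul_le χ _ (by linarith) _ _ _).trans (Finset.sum_le_sum fun j _ => ?_)
  rw [enorm_neg, enorm_one, one_mul, mul_assoc C₂, mul_assoc C₂]
  refine (hmul₂ _ _).trans ?_
  gcongr
  · exact hfb j
  · exact le_of_eq rfl

end MHD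

/-- **estimate (3.6).** For `N ≤ p < 2N − 1`,
`‖V₂(u,q)‖_{L¹(ℝ₊;Ḃ^{−1+N/p}_{p,1})} ≤ C (∑_{r=1}^{N−1} E(u)^r) ‖∇q‖_{L¹(ℝ₊;Ḃ^{−1+N/p}_{p,1})}`,
where `V₂(u,q)_i = −∑_j P_{ji} ∂_j q`. -/
theorem V2_estimate
    (N : ℕ) (hN : 2 ≤ N) (p : ℝ) (hp1 : (N : ℝ) ≤ p) (hp2 : p < 2 * N - 1)
    (χ : LPF (Euc N))
    (Q : Fin N → Fin N → MvPolynomial (Fin N × Fin N) ℝ) (hQ : IsCofactorPoly N Q) :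
    ∃ C : ℝ, 0 < C ∧
      ∀ u : ℝ → Euc N → Euc N, SmoothCpt N u →
      ∀ q : ℝ → Euc N → ℝ, SmoothCpt N q →
        (∑ i : Fin N, besovT χ (-1 + N / p) p (Set.Ioi 0) (fun t y =>
          (((-∑ j : Fin N, Pmat Q u t y j i * pdv j (q t) y : ℝ)) : ℂ))) ≤
        ENNReal.ofReal C *
          (∑ r ∈ Finset.Icc 1 (N - 1), EE χ (-1 + N / p) p u ^ r) *
          ∑ j : Fin N,
            besovT χ (-1 + N / p) p (Set.Ioi 0) (fun t y => ((pdv j (q t) y : ℝ) : ℂ)) := by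
  obtain ⟨C, hC, hle⟩ := besov_V2_component_le hN hp1 hp2 χ hQ
  have hfin : (∑ i, ∑ j, C i j) ≠ ∞ :=
    ENNReal.sum_ne_top.2 fun i _ => ENNReal.sum_ne_top.2 fun j _ => hC i j
  refine ⟨(∑ i, ∑ j, C i j).toReal + 1, by positivity, fun u hu q hq => ?_⟩
  set S := ∑ r ∈ Finset.Icc 1 (N - 1), EE χ (-1 + N / p) p u ^ r
  have hp0 : 0 < p := by
    have : (2 : ℝ) ≤ N := by exact_mod_cast hN
    linarith
  have hmeas : ∀ j, Measurable fun t =>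
      besov χ (-1 + N / p) p (fun y => ((pdv j (q t) y : ℝ) : ℂ)) := fun j =>
    SmoothCpt.measurable_besov (w := fun t y => ((pdv j (q t) y : ℝ) : ℂ))
      ((hq.pdv j).clm_comp Complex.ofRealCLM) χ _ hp0
  have hi : ∀ i, besovT χ (-1 + N / p) p (Set.Ioi 0) (fun t y =>
      (((-∑ j : Fin N, Pmat Q u t y j i * pdv j (q t) y : ℝ)) : ℂ)) ≤
      ∑ j, C i j * S *
        besovT χ (-1 + N / p) p (Set.Ioi 0) (fun t y => ((pdv j (q t) y : ℝ) : ℂ)) := fun i => by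
    refine (setLIntegral_mono' measurableSet_Ioi fun t ht => hle u hu q hq i t ht).trans_eq ?_
    rw [lintegral_finsetSum _ fun j _ => (hmeas j).const_mul _]
    exact Finset.sum_congr rfl fun j _ => lintegral_const_mul _ (hmeas j)
  calc _ ≤ ∑ i, ∑ j, C i j * S *
        besovT χ (-1 + N / p) p (Set.Ioi 0) (fun t y => ((pdv j (q t) y : ℝ) : ℂ)) :=
        Finset.sum_le_sum fun i _ => hi i
    _ ≤ ∑ i, ∑ j, C i j * S * ∑ l : Fin N,
        besovT χ (-1 + N / p) p (Set.Ioi 0) (fun t y => ((pdv l (q t) y : ℝ) : ℂ)) := by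
        gcongr with i _ j hj
        exact Finset.single_le_sum (f := fun l => besovT χ (-1 + N / p) p (Set.Ioi 0)
          (fun t y => ((pdv l (q t) y : ℝ) : ℂ))) (fun _ _ => zero_le) hj
    _ = (∑ i, ∑ j, C i j) * S * ∑ l : Fin N,
        besovT χ (-1 + N / p) p (Set.Ioi 0) (fun t y => ((pdv l (q t) y : ℝ) : ℂ)) := by
        simp only [Finset.sum_mul]
    _ ≤ _ := by
        gcongr
        rw [ENNReal.le_ofReal_iff_toReal_le hfin (by positivity)]
        linarith
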